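/- arXiv:0809.4726 — 2 statements merged into one kernel-verified Lean document; each statement's English description precedes it below -/
import Mathlib

section
/- Fix 0 < p < 1, τ ≥ 0 and ε with 0 < ε < κ_p(τ). Suppose t(n) is a sequence of nonnegative integers with t(n)/ln n → τ, and k(n) is a sequence of positive integers with k(n)/ln n → κ_p(τ) − ε as n → ∞. Then there exist a constant c > 0 and n_0 such that for all n ≥ n_0, Pr( α^{t(n)}(G(n,p)) < k(n) ) ≤ exp( −c·n²/(ln n)^5 ). -/
open MeasureTheory Filter
open scoped ENNReal NNReal

/-- The Bernoulli(p) measure on `Bool`. -/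
noncomputable def bernoulliBool (p : ℝ) : Measure Bool :=
  p.toNNReal • Measure.dirac true + (1 - p).toNNReal • Measure.dirac false

instance (p : ℝ) : IsFiniteMeasure (bernoulliBool p) := by
  unfold bernoulliBool; infer_instance

instance (n : ℕ) : MeasurableSpace (SimpleGraph (Fin n)) := ⊤

/-- The Erdős–Rényi random graph `G(n,p)`: the distribution of the simple graph on `Fin n`
obtained by including each possible edge independently with probability `p`. -/
noncomputable def erMeasure (n : ℕ) (p : ℝ) : Measure (SimpleGraph (Fin n)) :=
  Measure.map (fun f : Sym2 (Fin n) → Bool => SimpleGraph.fromEdgeSet {e | f e = true})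
    (Measure.pi fun _ : Sym2 (Fin n) => bernoulliBool p)

/-- A set `S` of vertices is `t`-dependent if the induced subgraph has maximum degree at most `t`,
i.e. every vertex of `S` has at most `t` neighbours inside `S`. -/
def IsTDependent {V : Type*} (G : SimpleGraph V) (t : ℕ) (S : Set V) : Prop :=
  ∀ v ∈ S, {u ∈ S | G.Adj v u}.ncard ≤ t

/-- The `t`-improper chromatic number: the least number of colours in a vertex colouring
in which every colour class is `t`-dependent. -/
noncomputable def improperChromaticNumber {V : Type*} (G : SimpleGraph V) (t : ℕ) : ℕ :=
  sInf {k | ∃ c : V → Fin k, ∀ i : Fin k, IsTDependent G t {v | c v = i}}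

/-- The `t`-dependence number: the maximum size of a `t`-dependent set. -/
noncomputable def tDependenceNumber {V : Type*} (G : SimpleGraph V) (t : ℕ) : ℕ :=
  sSup {m | ∃ S : Set V, S.ncard = m ∧ IsTDependent G t S}

/-- The Fenchel–Legendre transform `Λ*(x) = x ln(x/p) + (1-x) ln((1-x)/(1-p))`
(with the conventions `Λ*(0) = ln(1/(1-p))`, `Λ*(1) = ln(1/p)`, which hold automatically
since `Real.log 0 = 0` in Lean). -/
noncomputable def LambdaStar (p x : ℝ) : ℝ :=
  x * Real.log (x / p) + (1 - x) * Real.log ((1 - x) / (1 - p))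

section BernoulliProduct

variable {E : Type*}

lemma monotone_indicator_of_isUpperSet {s : Set (E → Bool)} (hs : IsUpperSet s) :
    Monotone (s.indicator (1 : (E → Bool) → ℝ)) := by
  intro f g hfg
  by_cases hf : f ∈ s
  · simp [hf, hs hfg hf]
  · simp only [Set.indicator_of_notMem hf]
    exact Set.indicator_nonneg (fun _ _ => zero_le_one) g

variable [Fintype E]

/-- The weight of `f : E → Bool` when the coordinates are independent and `f e` is `true` with
probability `r e`. -/
noncomputable def bernWeight (r : E → ℝ) (f : E → Bool) : ℝ :=
  ∏ e, if f e then r e else 1 - r e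

/-- The expectation of `g` under the product Bernoulli distribution with parameters `r`. -/
noncomputable def bernExp [DecidableEq E] (r : E → ℝ) (g : (E → Bool) → ℝ) : ℝ :=
  ∑ f, bernWeight r f * g f

/-- The probability of `s` under the product Bernoulli distribution with parameters `r`. -/
noncomputable def bernProb [DecidableEq E] (r : E → ℝ) (s : Set (E → Bool)) : ℝ :=
  bernExp r (s.indicator 1)

lemma bernWeight_nonneg {r : E → ℝ} (h0 : ∀ e, 0 ≤ r e) (h1 : ∀ e, r e ≤ 1) (f : E → Bool) :
    0 ≤ bernWeight r f := by
  refine Finset.prod_nonneg fun e _ => ?_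
  split_ifs
  exacts [h0 e, sub_nonneg.2 (h1 e)]

lemma bernWeight_mul_le (r : E → ℝ) (f g : E → Bool) :
    bernWeight r f * bernWeight r g ≤ bernWeight r (f ⊓ g) * bernWeight r (f ⊔ g) := by
  simp only [bernWeight, ← Finset.prod_mul_distrib]
  refine le_of_eq (Finset.prod_congr rfl fun e _ => ?_)
  rcases hf : f e <;> rcases hg : g e <;> simp [hf, hg, mul_comm]

variable [DecidableEq E]

lemma bernExp_prod (r : E → ℝ) (g : E → Bool → ℝ) :
    bernExp r (fun f => ∏ e, g e (f e)) = ∏ e, (r e * g e true + (1 - r e) * g e false) := by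
  have h := Finset.prod_univ_sum (fun _ : E => (Finset.univ : Finset Bool))
    (fun e b => (if b then r e else 1 - r e) * g e b)
  simp only [Fintype.piFinset_univ, Fintype.sum_bool] at h
  simp only [bernExp, bernWeight, ← Finset.prod_mul_distrib]
  simpa using h.symm

lemma bernExp_const (r : E → ℝ) (c : ℝ) : bernExp r (fun _ => c) = c := by
  have h := bernExp_prod r (fun _ _ => 1)
  simp only [bernExp, Finset.prod_const_one, mul_one, add_sub_cancel] at h ⊢
  rw [← Finset.sum_mul, h, one_mul]

lemma bernExp_add (r : E → ℝ) (g h : (E → Bool) → ℝ) :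
    bernExp r (fun f => g f + h f) = bernExp r g + bernExp r h := by
  simp only [bernExp, mul_add, Finset.sum_add_distrib]

lemma bernExp_sub (r : E → ℝ) (g h : (E → Bool) → ℝ) :
    bernExp r (fun f => g f - h f) = bernExp r g - bernExp r h := by
  simp only [bernExp, mul_sub, Finset.sum_sub_distrib]

lemma bernExp_const_mul (r : E → ℝ) (c : ℝ) (g : (E → Bool) → ℝ) :
    bernExp r (fun f => c * g f) = c * bernExp r g := by
  simp only [bernExp, Finset.mul_sum]
  exact Finset.sum_congr rfl fun f _ => by ring

lemma bernExp_sum {ι : Type*} (r : E → ℝ) (s : Finset ι) (g : ι → (E → Bool) → ℝ) :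
    bernExp r (fun f => ∑ i ∈ s, g i f) = ∑ i ∈ s, bernExp r (g i) := by
  simp only [bernExp, Finset.mul_sum]
  exact Finset.sum_comm

lemma bernExp_mono {r : E → ℝ} (h0 : ∀ e, 0 ≤ r e) (h1 : ∀ e, r e ≤ 1)
    {g h : (E → Bool) → ℝ} (hgh : ∀ f, g f ≤ h f) : bernExp r g ≤ bernExp r h :=
  Finset.sum_le_sum fun f _ => mul_le_mul_of_nonneg_left (hgh f) (bernWeight_nonneg h0 h1 f)

lemma bernProb_nonneg {r : E → ℝ} (h0 : ∀ e, 0 ≤ r e) (h1 : ∀ e, r e ≤ 1)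
    (s : Set (E → Bool)) : 0 ≤ bernProb r s := by
  rw [← bernExp_const r 0]
  exact bernExp_mono h0 h1 fun f => Set.indicator_nonneg (fun _ _ => zero_le_one) f

lemma bernProb_mono {r : E → ℝ} (h0 : ∀ e, 0 ≤ r e) (h1 : ∀ e, r e ≤ 1)
    {s u : Set (E → Bool)} (h : s ⊆ u) : bernProb r s ≤ bernProb r u :=
  bernExp_mono h0 h1 fun f => Set.indicator_le_indicator_of_subset h (fun _ => zero_le_one) f

lemma bernProb_univ (r : E → ℝ) : bernProb r Set.univ = 1 := by
  rw [bernProb, Set.indicator_univ]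
  exact bernExp_const r 1

lemma bernProb_compl (r : E → ℝ) (s : Set (E → Bool)) : bernProb r sᶜ = 1 - bernProb r s := by
  rw [← bernProb_univ r, bernProb, bernProb, bernProb, ← bernExp_sub]
  congr 1
  ext f
  by_cases hf : f ∈ s <;> simp [hf]

lemma bernProb_inter_add_diff (r : E → ℝ) (s u : Set (E → Bool)) :
    bernProb r (s ∩ u) + bernProb r (s \ u) = bernProb r s := by
  rw [bernProb, bernProb, bernProb, ← bernExp_add]
  congr 1
  ext f
  by_cases hf : f ∈ s <;> by_cases hu : f ∈ u <;> simp [hf, hu]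

lemma bernProb_biUnion_le {ι : Type*} {r : E → ℝ} (h0 : ∀ e, 0 ≤ r e) (h1 : ∀ e, r e ≤ 1)
    (J : Finset ι) (s : ι → Set (E → Bool)) :
    bernProb r (⋃ i ∈ J, s i) ≤ ∑ i ∈ J, bernProb r (s i) := by
  simp only [bernProb, ← bernExp_sum]
  refine bernExp_mono h0 h1 fun f => ?_
  have hn : ∀ i ∈ J, 0 ≤ (s i).indicator (1 : (E → Bool) → ℝ) f :=
    fun i _ => Set.indicator_nonneg (fun _ _ => zero_le_one) f
  by_cases hf : f ∈ ⋃ i ∈ J, s i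
  · obtain ⟨i, hi, hfi⟩ := by simpa using hf
    rw [Set.indicator_of_mem hf]
    exact (by simp [hfi] : (1 : (E → Bool) → ℝ) f ≤ (s i).indicator 1 f).trans
      (Finset.single_le_sum hn hi)
  · rw [Set.indicator_of_notMem hf]
    exact Finset.sum_nonneg hn

/-- Harris' inequality for two increasing events. -/
lemma bernProb_mul_le_inter_of_isUpperSet {r : E → ℝ} (h0 : ∀ e, 0 ≤ r e) (h1 : ∀ e, r e ≤ 1)
    {s u : Set (E → Bool)} (hs : IsUpperSet s) (hu : IsUpperSet u) :
    bernProb r s * bernProb r u ≤ bernProb r (s ∩ u) := by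
  have h := fkg (s.indicator (1 : (E → Bool) → ℝ)) (u.indicator 1) (bernWeight r)
    (bernWeight_nonneg h0 h1) (Set.indicator_nonneg fun _ _ => zero_le_one)
    (Set.indicator_nonneg fun _ _ => zero_le_one) (monotone_indicator_of_isUpperSet hs)
    (monotone_indicator_of_isUpperSet hu) (bernWeight_mul_le r)
  have hone : ∑ f, bernWeight r f = 1 := by simpa [bernExp] using bernExp_const r 1
  rw [hone, one_mul] at h
  refine h.trans_eq (Finset.sum_congr rfl fun f _ => ?_)
  rw [Set.inter_indicator_one]
  rfl

/-- Harris' inequality for a decreasing and an increasing event. -/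
lemma bernProb_inter_le_mul {r : E → ℝ} (h0 : ∀ e, 0 ≤ r e) (h1 : ∀ e, r e ≤ 1)
    {s u : Set (E → Bool)} (hs : IsLowerSet s) (hu : IsUpperSet u) :
    bernProb r (s ∩ u) ≤ bernProb r s * bernProb r u := by
  have h := bernProb_mul_le_inter_of_isUpperSet h0 h1 hs.compl hu
  have h' := bernProb_inter_add_diff r u s
  rw [bernProb_compl, Set.inter_comm, ← Set.sdiff_eq] at h
  rw [Set.inter_comm]
  linarith

/-- Harris' inequality for two decreasing events. -/
lemma bernProb_mul_le_inter_of_isLowerSet {r : E → ℝ} (h0 : ∀ e, 0 ≤ r e) (h1 : ∀ e, r e ≤ 1)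
    {s u : Set (E → Bool)} (hs : IsLowerSet s) (hu : IsLowerSet u) :
    bernProb r s * bernProb r u ≤ bernProb r (s ∩ u) := by
  have h := bernProb_inter_le_mul h0 h1 hs hu.compl
  have h' := bernProb_inter_add_diff r s u
  rw [bernProb_compl, ← Set.sdiff_eq] at h
  linarith

lemma prod_bernProb_le_biInter {ι : Type*} {r : E → ℝ} (h0 : ∀ e, 0 ≤ r e) (h1 : ∀ e, r e ≤ 1)
    (J : Finset ι) {s : ι → Set (E → Bool)} (hs : ∀ i, IsLowerSet (s i)) :
    ∏ i ∈ J, bernProb r (s i) ≤ bernProb r (⋂ i ∈ J, s i) := by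
  classical
  induction J using Finset.induction_on with
  | empty => simp [bernProb_univ]
  | insert i J hi ih =>
    rw [Finset.prod_insert hi, Finset.set_biInter_insert]
    exact (mul_le_mul_of_nonneg_left ih (bernProb_nonneg h0 h1 _)).trans
      (bernProb_mul_le_inter_of_isLowerSet h0 h1 (hs i)
        (isLowerSet_iInter₂ fun j _ => hs j))

/-- Functions of disjoint sets of coordinates are independent. -/
lemma bernExp_mul_of_dependsOn (r : E → ℝ) {g h : (E → Bool) → ℝ} (F : Finset E)
    (hg : DependsOn g (F : Set E)) (hh : DependsOn h (F : Set E)ᶜ) :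
    bernExp r (fun f => g f * h f) = bernExp r g * bernExp r h := by
  let φ := Equiv.piEquivPiSubtypeProd (fun e => e ∈ F) (fun _ : E => Bool)
  let w₁ : ({e // e ∈ F} → Bool) → ℝ := fun a => ∏ e, if a e then r e else 1 - r e
  let w₂ : ({e // e ∉ F} → Bool) → ℝ := fun b => ∏ e, if b e then r e else 1 - r e
  let a₀ : {e // e ∈ F} → Bool := fun _ => false
  let b₀ : {e // e ∉ F} → Bool := fun _ => false
  have hin : ∀ (x) (e : E) (he : e ∈ F), φ.symm x e = x.1 ⟨e, he⟩ := fun x e he => by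
    simp [φ, he]
  have hout : ∀ (x) (e : E) (he : e ∉ F), φ.symm x e = x.2 ⟨e, he⟩ := fun x e he => by
    simp [φ, he]
  have hw : ∀ x, bernWeight r (φ.symm x) = w₁ x.1 * w₂ x.2 := by
    intro x
    rw [bernWeight, ← Fintype.prod_subtype_mul_prod_subtype (fun e => e ∈ F)]
    congr 1
    · exact Finset.prod_congr (Finset.ext fun _ => by simp) fun e _ => by rw [hin x e e.2]
    · exact Finset.prod_congr (Finset.ext fun _ => by simp) fun e _ => by rw [hout x e e.2]
  have hg' : ∀ x, g (φ.symm x) = g (φ.symm (x.1, b₀)) := fun x =>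
    hg fun e he => by rw [hin _ e he, hin _ e he]
  have hh' : ∀ x, h (φ.symm x) = h (φ.symm (a₀, x.2)) := fun x =>
    hh fun e he => by rw [hout _ e he, hout _ e he]
  have key : ∀ k : (E → Bool) → ℝ, bernExp r k = ∑ x, w₁ x.1 * w₂ x.2 * k (φ.symm x) := by
    intro k
    rw [bernExp, ← φ.symm.sum_comp]
    exact Finset.sum_congr rfl fun x _ => by rw [hw]
  have hone : ∀ k : (E → Bool) → ℝ, ∀ (k₁ : ({e // e ∈ F} → Bool) → ℝ)
      (k₂ : ({e // e ∉ F} → Bool) → ℝ), (∀ x, k (φ.symm x) = k₁ x.1 * k₂ x.2) →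
      bernExp r k = (∑ a, w₁ a * k₁ a) * ∑ b, w₂ b * k₂ b := by
    intro k k₁ k₂ hk
    rw [key, Fintype.sum_prod_type, Finset.sum_mul_sum]
    exact Finset.sum_congr rfl fun a _ => Finset.sum_congr rfl fun b _ => by rw [hk]; ring
  have e₁ := hone (fun _ => 1) (fun _ => 1) (fun _ => 1) (by simp)
  have e₂ := hone g (fun a => g (φ.symm (a, b₀))) (fun _ => 1) (fun x => by simp [hg' x])
  have e₃ := hone h (fun _ => 1) (fun b => h (φ.symm (a₀, b))) (fun x => by simp [hh' x])
  have e₄ := hone (fun f => g f * h f) (fun a => g (φ.symm (a, b₀)))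
    (fun b => h (φ.symm (a₀, b))) (fun x => by rw [hg' x, hh' x])
  rw [bernExp_const] at e₁
  rw [e₂, e₃, e₄]
  linear_combination (-(∑ a, w₁ a * g (φ.symm (a, b₀))) * ∑ b, w₂ b * h (φ.symm (a₀, b))) * (-e₁)

lemma bernProb_inter_of_dependsOn (r : E → ℝ) {s u : Set (E → Bool)} (F : Finset E)
    (hs : DependsOn (· ∈ s) (F : Set E)) (hu : DependsOn (· ∈ u) (F : Set E)ᶜ) :
    bernProb r (s ∩ u) = bernProb r s * bernProb r u := by
  rw [bernProb, bernProb, bernProb, ← bernExp_mul_of_dependsOn r F]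
  · rw [Set.inter_indicator_one]
    rfl
  · intro f g hfg
    have : (f ∈ s) = (g ∈ s) := hs hfg
    by_cases h : g ∈ s <;> simp_all
  · intro f g hfg
    have : (f ∈ u) = (g ∈ u) := hu hfg
    by_cases h : g ∈ u <;> simp_all

end BernoulliProduct

section Janson

variable {E ι : Type*} [Fintype E] [DecidableEq E]

lemma bernExp_ite_apply (r : E → ℝ) (e : E) :
    bernExp r (fun f => if f e then (1 : ℝ) else 0) = r e := by
  have h := bernExp_prod r (fun e' b => if e' = e then (if b then (1 : ℝ) else 0) else 1)
  have hl : ∀ f : E → Bool, (∏ e', if e' = e then (if f e' then (1 : ℝ) else 0) else 1)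
      = if f e then 1 else 0 := fun f => by
    rw [Finset.prod_ite_eq' Finset.univ e]
    simp
  simp only [hl] at h
  rw [h, Finset.prod_eq_single e]
  · simp
  · intro e' _ he'
    simp [he']
  · simp

lemma bernExp_ite_apply_mul (r : E → ℝ) {e e' : E} (h : e ≠ e') :
    bernExp r (fun f => (if f e then (1 : ℝ) else 0) * (if f e' then 1 else 0)) = r e * r e' := by
  rw [bernExp_mul_of_dependsOn r {e}, bernExp_ite_apply, bernExp_ite_apply]
  · intro f g hfg
    simp [hfg e (by simp)]
  · intro f g hfg
    simp [hfg e' (by simpa using h.symm)]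

/-- The inductive step of Janson's inequality: adding one more event to avoid. -/
lemma bernProb_avoid_insert_le {r : E → ℝ} (h0 : ∀ e, 0 ≤ r e) (h1 : ∀ e, r e ≤ 1)
    {A : ι → Set (E → Bool)} {F : ι → Finset E} (hA : ∀ i, IsLowerSet (A i))
    (hF : ∀ i, DependsOn (· ∈ A i) (F i : Set E)) (J : Finset ι) (i : ι) :
    bernProb r ((A i)ᶜ ∩ ⋂ j ∈ J, (A j)ᶜ) ≤ bernProb r (⋂ j ∈ J, (A j)ᶜ) *
      Real.exp (-(bernProb r (A i) -
        ∑ j ∈ J with ¬ Disjoint (F i) (F j), bernProb r (A i ∩ A j))) := by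
  set U := ⋂ j ∈ J, (A j)ᶜ with hU
  set W := ⋂ j ∈ J.filter (fun j => Disjoint (F i) (F j)), (A j)ᶜ with hW
  set M := J.filter (fun j => ¬ Disjoint (F i) (F j)) with hM
  set D := ∑ j ∈ M, bernProb r (A i ∩ A j) with hD
  have hUW : U ⊆ W := Set.biInter_subset_biInter_left fun j hj => (Finset.mem_filter.1 hj).1
  have hWup : IsUpperSet W := isUpperSet_iInter₂ fun j _ => (hA j).compl
  have hind : bernProb r (A i ∩ W) = bernProb r (A i) * bernProb r W := by
    refine bernProb_inter_of_dependsOn r (F i) (hF i) fun f g hfg => ?_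
    have : ∀ j ∈ J.filter (fun j => Disjoint (F i) (F j)), (f ∈ A j) = (g ∈ A j) := by
      intro j hj
      exact hF j fun e he =>
        hfg e (fun he' => Finset.disjoint_left.1 (Finset.mem_filter.1 hj).2 he' he)
    simp only [hW, Set.mem_iInter, Set.mem_compl_iff]
    exact forall₂_congr (fun j hj => by rw [this j hj]) |> propext
  have hsub : (A i ∩ W) \ U ⊆ ⋃ j ∈ M, A i ∩ A j ∩ W := by
    rintro f ⟨⟨hfi, hfW⟩, hfU⟩
    simp only [hU, Set.mem_iInter, Set.mem_compl_iff, not_forall, not_not] at hfU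
    obtain ⟨j, hjJ, hfj⟩ := hfU
    have hjM : j ∈ M := by
      refine Finset.mem_filter.2 ⟨hjJ, fun hdis => ?_⟩
      exact Set.mem_iInter₂.1 hfW j (Finset.mem_filter.2 ⟨hjJ, hdis⟩) hfj
    exact Set.mem_iUnion₂.2 ⟨j, hjM, ⟨hfi, hfj⟩, hfW⟩
  have hle : bernProb r ((A i ∩ W) \ U) ≤ D * bernProb r W := by
    refine ((bernProb_mono h0 h1 hsub).trans (bernProb_biUnion_le h0 h1 _ _)).trans ?_
    rw [hD, Finset.sum_mul]
    exact Finset.sum_le_sum fun j _ =>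
      bernProb_inter_le_mul h0 h1 ((hA i).inter (hA j)) hWup
  have hsplit := bernProb_inter_add_diff r (A i ∩ W) U
  have hAU : A i ∩ W ∩ U = A i ∩ U := by rw [Set.inter_assoc, Set.inter_eq_right.2 hUW]
  have hcompl := bernProb_inter_add_diff r U (A i)
  rw [Set.sdiff_eq, Set.inter_comm U, Set.inter_comm U] at hcompl
  rw [hAU, hind] at hsplit
  have hPU := bernProb_nonneg h0 h1 U
  have hkey : bernProb r U * (bernProb r (A i) - D) ≤ bernProb r (A i ∩ U) := by
    rcases le_total 0 (bernProb r (A i) - D) with h | h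
    · nlinarith [mul_le_mul_of_nonneg_right (bernProb_mono h0 h1 hUW) h]
    · exact (mul_nonpos_of_nonneg_of_nonpos hPU h).trans (bernProb_nonneg h0 h1 _)
  have hexp := Real.add_one_le_exp (-(bernProb r (A i) - D))
  nlinarith [mul_le_mul_of_nonneg_left hexp hPU]

variable [DecidableEq ι]

lemma bernProb_avoid_le_exp {r : E → ℝ} (h0 : ∀ e, 0 ≤ r e) (h1 : ∀ e, r e ≤ 1)
    {A : ι → Set (E → Bool)} {F : ι → Finset E} (hA : ∀ i, IsLowerSet (A i))
    (hF : ∀ i, DependsOn (· ∈ A i) (F i : Set E)) (J : Finset ι) :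
    bernProb r (⋂ j ∈ J, (A j)ᶜ) ≤ Real.exp (-∑ i ∈ J, bernProb r (A i) + 1 / 2 *
      ∑ i ∈ J, ∑ j ∈ J,
        if i ≠ j ∧ ¬ Disjoint (F i) (F j) then bernProb r (A i ∩ A j) else 0) := by
  induction J using Finset.induction_on with
  | empty => simp [bernProb_univ]
  | insert i J hi ih =>
    rw [Finset.set_biInter_insert]
    refine (bernProb_avoid_insert_le h0 h1 hA hF J i).trans
      ((mul_le_mul_of_nonneg_right ih (Real.exp_pos _).le).trans_eq ?_)
    have hne : ∀ j ∈ J, i ≠ j := fun j hj h => hi (h ▸ hj)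
    have e₁ : (∑ j ∈ J, if i ≠ j ∧ ¬ Disjoint (F i) (F j) then bernProb r (A i ∩ A j) else 0)
        = ∑ j ∈ J with ¬ Disjoint (F i) (F j), bernProb r (A i ∩ A j) := by
      rw [Finset.sum_filter]
      exact Finset.sum_congr rfl fun j hj => by simp [hne j hj]
    have e₂ : (∑ j ∈ J, if j ≠ i ∧ ¬ Disjoint (F j) (F i) then bernProb r (A j ∩ A i) else 0)
        = ∑ j ∈ J with ¬ Disjoint (F i) (F j), bernProb r (A i ∩ A j) := by
      rw [Finset.sum_filter]
      exact Finset.sum_congr rfl fun j hj => by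
        simp [(hne j hj).symm, disjoint_comm, Set.inter_comm]
    rw [← Real.exp_add, Finset.sum_insert hi, Finset.sum_insert hi, Finset.sum_insert hi, e₁]
    simp only [Finset.sum_insert hi, Finset.sum_add_distrib, e₂]
    congr 1
    simp only [ne_eq, not_true_eq_false, false_and, if_false]
    ring

/-- Janson's inequality for decreasing events `A i`, each determined by the coordinates `F i`. -/
theorem bernProb_avoid_le [Fintype ι] {r : E → ℝ} (h0 : ∀ e, 0 ≤ r e) (h1 : ∀ e, r e ≤ 1)
    {A : ι → Set (E → Bool)} {F : ι → Finset E} (hA : ∀ i, IsLowerSet (A i))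
    (hF : ∀ i, DependsOn (· ∈ A i) (F i : Set E)) {Δ : ℝ} (hΔ : 0 < Δ)
    (hμ : ∑ i, bernProb r (A i) ≤ Δ)
    (hpairs : ∑ i, ∑ j, (if ¬ Disjoint (F i) (F j) then bernProb r (A i ∩ A j) else 0) ≤ Δ) :
    bernProb r (⋂ i, (A i)ᶜ) ≤ Real.exp (-((∑ i, bernProb r (A i)) ^ 2 / (2 * Δ))) := by
  set μ := ∑ i, bernProb r (A i) with hμdef
  rcases (bernProb_nonneg h0 h1 (⋂ i, (A i)ᶜ)).eq_or_lt with hP | hP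
  · rw [← hP]
    exact (Real.exp_pos _).le
  let d : ι → ι → ℝ := fun i j =>
    if i ≠ j ∧ ¬ Disjoint (F i) (F j) then bernProb r (A i ∩ A j) else 0
  let χ : ι → (ι → Bool) → ℝ := fun i f => if f i then 1 else 0
  let L := Real.log (bernProb r (⋂ i, (A i)ᶜ))
  set s := μ / Δ with hs
  have hμ0 : 0 ≤ μ := Finset.sum_nonneg fun i _ => bernProb_nonneg h0 h1 _
  have hs0 : 0 ≤ s := div_nonneg hμ0 hΔ.le
  have hs1 : s ≤ 1 := (div_le_one hΔ).2 hμ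
  have hdΔ : ∑ i, ∑ j, d i j ≤ Δ := by
    refine le_trans (Finset.sum_le_sum fun i _ => Finset.sum_le_sum fun j _ => ?_) hpairs
    have := bernProb_nonneg h0 h1 (A i ∩ A j)
    by_cases hij : Disjoint (F i) (F j) <;> by_cases h : i = j <;> simp [d, hij, h] <;>
      simp_all
  have hsubset : ∀ f : ι → Bool,
      L + ∑ i, bernProb r (A i) * χ i f - 1 / 2 * ∑ i, ∑ j, d i j * (χ i f * χ j f) ≤ 0 := by
    intro f
    have h := bernProb_avoid_le_exp h0 h1 hA hF (Finset.univ.filter fun i => f i = true)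
    have h' := Real.log_le_log hP ((bernProb_mono h0 h1 (by
      exact fun x hx => Set.mem_iInter₂.2 fun i _ => Set.mem_iInter.1 hx i)).trans h)
    rw [Real.log_exp] at h'
    have e₁ : ∑ i with f i = true, bernProb r (A i) = ∑ i, bernProb r (A i) * χ i f := by
      simp [Finset.sum_filter, χ]
    have e₂ : (∑ i with f i = true, ∑ j with f j = true, d i j)
        = ∑ i, ∑ j, d i j * (χ i f * χ j f) := by
      simp only [Finset.sum_filter]
      refine Finset.sum_congr rfl fun i _ => ?_
      by_cases hi : f i = true <;> simp [hi, χ]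
    change L ≤ -_ + 1 / 2 * (∑ i with f i = true, ∑ j with f j = true, d i j) at h'
    rw [e₁, e₂] at h'
    linarith
  have havg := bernExp_mono (r := fun _ : ι => s) (fun _ => hs0) (fun _ => hs1) hsubset
  rw [bernExp_const, bernExp_sub, bernExp_add, bernExp_const, bernExp_const_mul,
    bernExp_sum, bernExp_sum] at havg
  have e₁ : ∑ i, bernExp (fun _ : ι => s) (fun f => bernProb r (A i) * χ i f) = s * μ := by
    rw [hμdef, Finset.mul_sum]
    refine Finset.sum_congr rfl fun i _ => ?_
    rw [bernExp_const_mul, bernExp_ite_apply, mul_comm]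
  have e₂ : ∑ i, bernExp (fun _ : ι => s) (fun f => ∑ j, d i j * (χ i f * χ j f))
      = s ^ 2 * ∑ i, ∑ j, d i j := by
    rw [Finset.mul_sum]
    refine Finset.sum_congr rfl fun i _ => ?_
    rw [bernExp_sum, Finset.mul_sum]
    refine Finset.sum_congr rfl fun j _ => ?_
    rw [bernExp_const_mul]
    by_cases hij : i = j
    · simp [d, hij]
    · rw [bernExp_ite_apply_mul _ hij]
      ring
  rw [e₁, e₂] at havg
  rw [← Real.log_le_iff_le_exp hP]
  have e₃ : μ ^ 2 / (2 * Δ) = s * μ - 1 / 2 * (s ^ 2 * Δ) := by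
    rw [hs]
    field_simp
    ring
  have := mul_le_mul_of_nonneg_left hdΔ (sq_nonneg s)
  rw [e₃]
  linarith

end Janson

section BoundedDegree

variable {V : Type*} [DecidableEq V]

/-- The edges of the complete graph on `S`. -/
def pairsWithin (S : Finset V) : Finset (Sym2 V) :=
  S.offDiag.image (Function.uncurry Sym2.mk)

/-- The configurations in which every vertex of `S` has at most `t` neighbours in `S` along
edges in `F`. -/
def degLE (t : ℕ) (S : Finset V) (F : Finset (Sym2 V)) : Set (Sym2 V → Bool) :=
  {f | ∀ v ∈ S, (S.filter fun u => s(v, u) ∈ F ∧ f s(v, u) = true).card ≤ t}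

lemma mk_mem_pairsWithin {S : Finset V} {a b : V} :
    s(a, b) ∈ pairsWithin S ↔ a ∈ S ∧ b ∈ S ∧ a ≠ b := by
  simp only [pairsWithin, Finset.mem_image, Finset.mem_offDiag, Prod.exists,
    Function.uncurry_apply_pair, Sym2.eq_iff]
  constructor
  · rintro ⟨x, y, ⟨hx, hy, hxy⟩, ⟨rfl, rfl⟩ | ⟨rfl, rfl⟩⟩
    exacts [⟨hx, hy, hxy⟩, ⟨hy, hx, hxy.symm⟩]
  · exact fun h => ⟨a, b, h, Or.inl ⟨rfl, rfl⟩⟩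

lemma card_pairsWithin (S : Finset V) : (pairsWithin S).card = S.card.choose 2 :=
  Sym2.card_image_offDiag S

lemma pairsWithin_inter (S T : Finset V) :
    pairsWithin (S ∩ T) = pairsWithin S ∩ pairsWithin T := by
  ext e
  induction e with
  | _ a b =>
    simp only [Finset.mem_inter, mk_mem_pairsWithin]
    tauto

lemma isLowerSet_degLE (t : ℕ) (S : Finset V) (F : Finset (Sym2 V)) :
    IsLowerSet (degLE t S F) := by
  intro f g hgf hf v hv
  refine (Finset.card_le_card fun u hu => ?_).trans (hf v hv)
  simp only [Finset.mem_filter] at hu ⊢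
  have hle : g s(v, u) ≤ f s(v, u) := hgf s(v, u)
  exact ⟨hu.1, hu.2.1, top_le_iff.1 (by simpa [hu.2.2] using hle)⟩

lemma dependsOn_degLE (t : ℕ) (S : Finset V) (F : Finset (Sym2 V)) :
    DependsOn (· ∈ degLE t S F) (F : Set (Sym2 V)) := by
  intro f g hfg
  have : ∀ v u, (s(v, u) ∈ F ∧ f s(v, u) = true) ↔ (s(v, u) ∈ F ∧ g s(v, u) = true) :=
    fun v u => and_congr_right fun h => by rw [hfg _ h]
  simp only [degLE, Set.mem_ofPred_eq, this]

lemma degLE_anti (t : ℕ) (S : Finset V) {F G : Finset (Sym2 V)} (h : F ⊆ G) :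
    degLE t S G ⊆ degLE t S F := fun _ hf v hv =>
  (Finset.card_le_card (Finset.monotone_filter_right S
    fun _ _ hu => ⟨h hu.1, hu.2⟩)).trans (hf v hv)

variable [Fintype V]

lemma bernProb_degLE_inter_le {r : Sym2 V → ℝ} (h0 : ∀ e, 0 ≤ r e) (h1 : ∀ e, r e ≤ 1)
    (t : ℕ) (S T : Finset V) :
    bernProb r (degLE t S (pairsWithin S) ∩ degLE t T (pairsWithin T)) ≤
      bernProb r (degLE t S (pairsWithin S)) *
        bernProb r (degLE t T (pairsWithin T \ pairsWithin (S ∩ T))) := by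
  rw [← bernProb_inter_of_dependsOn r (pairsWithin S) (dependsOn_degLE t S _)]
  · exact bernProb_mono h0 h1 (Set.inter_subset_inter_right _
      (degLE_anti t T Finset.sdiff_subset))
  · refine (dependsOn_degLE t T _).mono fun e he heS => ?_
    rw [Finset.mem_coe, pairsWithin_inter, Finset.mem_sdiff, Finset.mem_inter] at he
    exact he.2 ⟨heS, he.1⟩

lemma bernProb_forall_eq_false {E : Type*} [Fintype E] [DecidableEq E] (r : E → ℝ)
    (G : Finset E) : bernProb r {f | ∀ e ∈ G, f e = false} = ∏ e ∈ G, (1 - r e) := by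
  have h := bernExp_prod r (fun e b => if e ∈ G ∧ b = true then 0 else 1)
  have hl : ∀ f : E → Bool, (∏ e, if e ∈ G ∧ f e = true then (0 : ℝ) else 1) =
      {f | ∀ e ∈ G, f e = false}.indicator 1 f := by
    intro f
    by_cases hf : ∀ e ∈ G, f e = false
    · rw [Set.indicator_of_mem (by exact hf)]
      exact Finset.prod_eq_one fun e _ => if_neg fun he => by simp [hf e he.1] at he
    · rw [Set.indicator_of_notMem (by exact hf)]
      push Not at hf
      obtain ⟨e, he, hfe⟩ := hf
      exact Finset.prod_eq_zero (Finset.mem_univ e) (if_pos ⟨he, by simpa using hfe⟩)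
  simp only [hl] at h
  refine h.trans ?_
  rw [← Finset.prod_filter_mul_prod_filter_not Finset.univ (fun e => e ∈ G)]
  rw [Finset.prod_eq_one (s := Finset.univ.filter fun e => ¬ e ∈ G)
    (fun e he => by simp [(Finset.mem_filter.1 he).2]), mul_one]
  refine Finset.prod_congr (by ext; simp) fun e he => by simp [he]

lemma bernProb_degLE_sdiff_mul_le {r : Sym2 V → ℝ} (h0 : ∀ e, 0 ≤ r e) (h1 : ∀ e, r e ≤ 1)
    (t : ℕ) (T : Finset V) (F G : Finset (Sym2 V)) :
    bernProb r (degLE t T (F \ G)) * ∏ e ∈ G, (1 - r e) ≤ bernProb r (degLE t T F) := by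
  rw [← bernProb_forall_eq_false, mul_comm, ← bernProb_inter_of_dependsOn r G]
  · refine bernProb_mono h0 h1 fun f hf v hv => ?_
    refine (Finset.card_le_card fun u hu => ?_).trans (hf.2 v hv)
    simp only [Finset.mem_filter, Finset.mem_sdiff] at hu ⊢
    exact ⟨hu.1, ⟨hu.2.1, fun hG => by simp [hf.1 _ hG] at hu⟩, hu.2.2⟩
  · intro f g hfg
    simp only [Set.mem_ofPred_eq]
    exact propext (forall₂_congr fun e he => by rw [hfg e he])
  · exact (dependsOn_degLE t T _).mono fun e he heG => (Finset.mem_sdiff.1 he).2 heG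

lemma bernProb_degLE_eq_of_card_eq (p : ℝ) (t : ℕ) {S T : Finset V} (h : S.card = T.card) :
    bernProb (fun _ => p) (degLE t S (pairsWithin S)) =
      bernProb (fun _ => p) (degLE t T (pairsWithin T)) := by
  let e : {x // x ∈ S} ≃ {x // x ∈ T} := Finset.equivOfCardEq h
  let σ := e.extendSubtype
  have hσ : ∀ x, σ x ∈ T ↔ x ∈ S := fun x =>
    ⟨fun hx => by_contra fun hxS => e.extendSubtype_not_mem x hxS hx, e.extendSubtype_mem x⟩
  let ψ : Sym2 V ≃ Sym2 V := Equiv.ofBijective (Sym2.map σ)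
    (Finite.injective_iff_bijective.1 (Sym2.map.injective σ.injective))
  let φ : (Sym2 V → Bool) ≃ (Sym2 V → Bool) := ψ.arrowCongr (Equiv.refl Bool)
  have hφ : ∀ f a b, φ f s(σ a, σ b) = f s(a, b) := fun f a b =>
    congrArg f (ψ.symm_apply_apply s(a, b))
  rw [bernProb, bernProb, bernExp, bernExp,
    ← φ.sum_comp fun f => bernWeight _ f * (degLE t T (pairsWithin T)).indicator 1 f]
  refine Finset.sum_congr rfl fun f _ => ?_
  congr 1
  · exact (Equiv.prod_comp ψ.symm
      (fun e => if f e = true then p else 1 - p)).symm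
  · have hmem : φ f ∈ degLE t T (pairsWithin T) ↔ f ∈ degLE t S (pairsWithin S) := by
      have hcard : ∀ v, (T.filter fun u => s(σ v, u) ∈ pairsWithin T ∧
          φ f s(σ v, u) = true).card = (S.filter fun u => s(v, u) ∈ pairsWithin S ∧
          f s(v, u) = true).card := by
        intro v
        symm
        refine Finset.card_bij (fun u _ => σ u) (fun u hu => ?_)
          (fun _ _ _ _ h => σ.injective h) (fun u hu => ?_)
        · simpa [mk_mem_pairsWithin, hσ, hφ] using hu
        · obtain ⟨w, rfl⟩ := σ.surjective u
          exact ⟨w, by simpa [mk_mem_pairsWithin, hσ, hφ] using hu, rfl⟩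
      constructor
      · intro hf v hv
        rw [← hcard]
        exact hf _ ((hσ v).2 hv)
      · intro hf u hu
        obtain ⟨w, rfl⟩ := σ.surjective u
        rw [hcard]
        exact hf w ((hσ w).1 hu)
    by_cases hf : f ∈ degLE t S (pairsWithin S)
    · rw [Set.indicator_of_mem hf, Set.indicator_of_mem (hmem.2 hf)]
      rfl
    · rw [Set.indicator_of_notMem hf, Set.indicator_of_notMem (mt hmem.1 hf)]

lemma mul_pow_add_le_sqrt_pow {p ζ : ℝ} (hp0 : 0 ≤ p) (hp1 : p ≤ 1) {c : ℕ} (hc : c ≤ 2) :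
    p * ζ ^ c + (1 - p) ≤ Real.sqrt (1 - p + p * ζ ^ 2) ^ c := by
  have hq : 0 ≤ 1 - p := sub_nonneg.2 hp1
  have hρ : 0 ≤ 1 - p + p * ζ ^ 2 := by positivity
  interval_cases c
  · simp
  · rw [pow_one, pow_one]
    refine Real.le_sqrt_of_sq_le ?_
    nlinarith [mul_nonneg (mul_nonneg hp0 hq) (sq_nonneg (1 - ζ))]
  · rw [Real.sq_sqrt hρ, add_comm]

/-- Chernoff bound for the sum of the degrees of the vertices in `T \ U`: an edge with both ends in
`T \ U` is counted twice, an edge with one end there once. -/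
lemma bernProb_degLE_sdiff_le {p ζ : ℝ} (hp0 : 0 ≤ p) (hp1 : p ≤ 1) (hζ0 : 0 ≤ ζ) (hζ1 : ζ ≤ 1)
    (t : ℕ) (T U : Finset V) :
    ζ ^ (t * (T \ U).card) *
        bernProb (fun _ => p) (degLE t T (pairsWithin T \ pairsWithin U)) ≤
      Real.sqrt (1 - p + p * ζ ^ 2) ^ ((T \ U).card * (T.card - 1)) := by
  let Q : Finset (Σ _ : V, V) := (T \ U).sigma fun v => T.erase v
  let m : (Σ _ : V, V) → Sym2 V := fun x => s(x.1, x.2)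
  let c : Sym2 V → ℕ := fun e => (Q.filter fun x => m x = e).card
  have hc : ∀ e, c e ≤ 2 := by
    intro e
    induction e with
    | _ a b =>
      refine (Finset.card_le_card (t := {⟨a, b⟩, ⟨b, a⟩}) fun x hx => ?_).trans
        Finset.card_le_two
      obtain ⟨x₁, x₂⟩ := x
      have := (Finset.mem_filter.1 hx).2
      simp only [m, Sym2.eq_iff] at this
      rcases this with ⟨rfl, rfl⟩ | ⟨rfl, rfl⟩ <;> simp
  have hcsum : ∑ e, c e = (T \ U).card * (T.card - 1) := by
    rw [← Finset.card_eq_sum_card_fiberwise (f := m) (s := Q) (fun x _ => by simp),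
      Finset.card_sigma, Finset.sum_const_nat fun v hv =>
        Finset.card_erase_of_mem (Finset.mem_sdiff.1 hv).1]
  have hpt : ∀ f : Sym2 V → Bool,
      ζ ^ (t * (T \ U).card) * (degLE t T (pairsWithin T \ pairsWithin U)).indicator 1 f ≤
        ∏ e, if f e = true then ζ ^ c e else 1 := by
    intro f
    by_cases hf : f ∈ degLE t T (pairsWithin T \ pairsWithin U)
    · rw [Set.indicator_of_mem hf, Pi.one_apply, mul_one]
      have hprod : (∏ e, if f e = true then ζ ^ c e else 1) =
          ∏ v ∈ T \ U, ∏ u ∈ T.erase v, if f s(v, u) = true then ζ else 1 := by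
        rw [← Finset.prod_sigma (T \ U) (fun v => T.erase v)
            (fun x => if f (m x) = true then ζ else 1),
          ← Finset.prod_fiberwise _ m]
        refine Finset.prod_congr rfl fun e _ => ?_
        rw [Finset.prod_congr rfl (g := fun _ => if f e = true then ζ else 1)
          (fun x hx => by rw [(Finset.mem_filter.1 hx).2]), Finset.prod_const]
        split_ifs
        · rfl
        · rw [one_pow]
      rw [hprod, pow_mul, ← Finset.prod_const]
      refine Finset.prod_le_prod (fun _ _ => pow_nonneg hζ0 _) fun v hv => ?_
      rw [Finset.mem_sdiff] at hv
      rw [← Finset.prod_filter, Finset.prod_const]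
      refine pow_le_pow_of_le_one hζ0 hζ1 ((Finset.card_le_card fun u hu => ?_).trans (hf v hv.1))
      simp only [Finset.mem_filter, Finset.mem_erase, Finset.mem_sdiff,
        mk_mem_pairsWithin] at hu ⊢
      exact ⟨hu.1.2, ⟨⟨hv.1, hu.1.2, hu.1.1.symm⟩, fun h => hv.2 h.1⟩, hu.2⟩
    · rw [Set.indicator_of_notMem hf, mul_zero]
      exact Finset.prod_nonneg fun e _ => by split_ifs <;> positivity
  rw [bernProb, ← bernExp_const_mul]
  refine (bernExp_mono (fun _ => hp0) (fun _ => hp1) hpt).trans ?_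
  rw [bernExp_prod (fun _ => p) fun e b => if b = true then ζ ^ c e else 1, ← hcsum,
    ← Finset.prod_pow_eq_pow_sum]
  refine Finset.prod_le_prod (fun e _ => ?_) fun e _ => ?_
  · have : 0 ≤ 1 - p := sub_nonneg.2 hp1
    simp only [if_true]
    positivity
  · simpa using mul_pow_add_le_sqrt_pow hp0 hp1 (hc e)

/-- A lower tail bound for the number of successes among the coordinates in `F`. -/
lemma bernProb_card_lt_le {E : Type*} [Fintype E] [DecidableEq E] {r : E → ℝ}
    (h0 : ∀ e, 0 ≤ r e) (h1 : ∀ e, r e ≤ 1) {F : Finset E} {y η : ℝ} (hy0 : 0 ≤ y) (hy1 : y ≤ 1)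
    (hr : ∀ e ∈ F, r e = y) (hη0 : 0 ≤ η) (hη1 : η ≤ 1) :
    bernProb r {f | ((F.filter fun e => f e = true).card : ℝ) < (y - η) * F.card} ≤
      Real.exp (-(η ^ 2 / 4 * F.card)) := by
  set s := η / 2 with hs
  set N : ℝ := (F.card : ℝ) with hN
  have hpt : ∀ f : E → Bool,
      {f | ((F.filter fun e => f e = true).card : ℝ) < (y - η) * N}.indicator 1 f ≤
        Real.exp (s * ((y - η) * N)) *
          ∏ e, if e ∈ F ∧ f e = true then Real.exp (-s) else 1 := by
    intro f
    have hprod : (∏ e, if e ∈ F ∧ f e = true then Real.exp (-s) else 1) =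
        Real.exp (-s * (F.filter fun e => f e = true).card) := by
      rw [← Finset.prod_filter, Finset.prod_const, ← Real.exp_nat_mul, mul_comm]
      congr 4
      ext; simp
    rw [hprod, ← Real.exp_add]
    by_cases hf : ((F.filter fun e => f e = true).card : ℝ) < (y - η) * N
    · rw [Set.indicator_of_mem (by exact hf)]
      refine Real.one_le_exp ?_
      nlinarith
    · rw [Set.indicator_of_notMem (by exact hf)]
      exact (Real.exp_pos _).le
  refine (bernExp_mono h0 h1 hpt).trans ?_
  rw [bernExp_const_mul,
    bernExp_prod r fun e b => if e ∈ F ∧ b = true then Real.exp (-s) else 1]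
  have hexp : Real.exp (-s) ≤ 1 - s + s ^ 2 := by
    have := Real.abs_exp_sub_one_sub_id_le (x := -s) (by rw [abs_neg, abs_of_nonneg] <;> linarith)
    have := (abs_le.1 this).2
    linarith [neg_sq s]
  have hbase : ∏ e, (r e * (if e ∈ F ∧ true = true then Real.exp (-s) else 1) +
      (1 - r e) * if e ∈ F ∧ false = true then Real.exp (-s) else 1) =
      (y * Real.exp (-s) + (1 - y)) ^ F.card := by
    rw [← Finset.prod_const, ← Finset.prod_subset (Finset.subset_univ F)]
    · exact Finset.prod_congr rfl fun e he => by simp [he, hr e he]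
    · intro e _ he
      simp [he]
  have hle : y * Real.exp (-s) + (1 - y) ≤ Real.exp (y * (-s + s ^ 2)) := by
    have := Real.add_one_le_exp (y * (-s + s ^ 2))
    nlinarith
  have hnn : 0 ≤ y * Real.exp (-s) + (1 - y) := by
    have := Real.exp_pos (-s)
    have : 0 ≤ 1 - y := by linarith
    positivity
  rw [hbase]
  refine (mul_le_mul_of_nonneg_left (pow_le_pow_left₀ hnn hle _) (Real.exp_pos _).le).trans ?_
  rw [← Real.exp_nat_mul, ← Real.exp_add]
  refine Real.exp_le_exp.2 ?_
  have hN0 : 0 ≤ N := Nat.cast_nonneg _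
  have : y * (N * s ^ 2) ≤ N * s ^ 2 := mul_le_of_le_one_left (by positivity) hy1
  rw [← hN]
  calc _ = y * (N * s ^ 2) - s * η * N := by ring
    _ ≤ N * s ^ 2 - s * η * N := by linarith
    _ = _ := by rw [hs]; ring

lemma prod_le_bernProb_degLE {r : Sym2 V → ℝ} (h0 : ∀ e, 0 ≤ r e) (h1 : ∀ e, r e ≤ 1)
    {t : ℕ} {S : Finset V} {y : ℝ} (hr : ∀ e ∈ pairsWithin S, r e = y)
    (ht : y * ((S.card : ℝ) - 1) ≤ t) :
    (1 / ((t : ℝ) + 1)) ^ S.card ≤ bernProb r (degLE t S (pairsWithin S)) := by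
  let D : V → Set (Sym2 V → Bool) := fun v =>
    {f | (S.filter fun u => s(v, u) ∈ pairsWithin S ∧ f s(v, u) = true).card ≤ t}
  have hD : degLE t S (pairsWithin S) = ⋂ v ∈ S, D v := by
    ext f
    simp [degLE, D]
  have hlow : ∀ v, IsLowerSet (D v) := by
    intro v f g hgf hf
    refine (Finset.card_le_card fun u hu => ?_).trans hf
    simp only [Finset.mem_filter] at hu ⊢
    have hle : g s(v, u) ≤ f s(v, u) := hgf s(v, u)
    exact ⟨hu.1, hu.2.1, top_le_iff.1 (by simpa [hu.2.2] using hle)⟩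
  rw [hD, ← Finset.prod_const]
  refine le_trans (Finset.prod_le_prod (fun _ _ => by positivity) fun v hv => ?_)
    (prod_bernProb_le_biInter h0 h1 S hlow)
  have hpt : ∀ f : Sym2 V → Bool, (D v)ᶜ.indicator 1 f ≤
      1 / ((t : ℝ) + 1) * ∑ u ∈ S.erase v, if f s(v, u) = true then (1 : ℝ) else 0 := by
    intro f
    by_cases hf : f ∈ D v
    · rw [Set.indicator_of_notMem (by simpa using hf)]
      exact mul_nonneg (by positivity) (Finset.sum_nonneg fun u _ => by split_ifs <;> simp)
    · rw [Set.indicator_of_mem (by simpa using hf), Finset.sum_boole]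
      have hfilter : (S.filter fun u => s(v, u) ∈ pairsWithin S ∧ f s(v, u) = true) =
          (S.erase v).filter fun u => f s(v, u) = true := by
        ext u
        simp only [Finset.mem_filter, Finset.mem_erase, mk_mem_pairsWithin, ne_comm]
        tauto
      have hlt : t + 1 ≤ ((S.erase v).filter fun u => f s(v, u) = true).card := by
        rw [← hfilter]
        exact not_le.1 (show ¬ _ ≤ t from hf)
      have : ((t : ℝ) + 1) ≤ ((S.erase v).filter fun u => f s(v, u) = true).card := by
        exact_mod_cast hlt
      rw [one_div, ← div_eq_inv_mul, Pi.one_apply]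
      exact (one_le_div (by positivity)).2 this
  have hcompl := bernExp_mono h0 h1 hpt
  rw [bernExp_const_mul, bernExp_sum] at hcompl
  have hsum : ∑ u ∈ S.erase v, bernExp r (fun f => if f s(v, u) = true then (1 : ℝ) else 0) =
      y * ((S.card : ℝ) - 1) := by
    rw [Finset.sum_congr rfl (g := fun _ => y) fun u hu => ?_, Finset.sum_const,
      Finset.card_erase_of_mem hv, nsmul_eq_mul, Nat.cast_pred (Finset.card_pos.2 ⟨v, hv⟩),
      mul_comm]
    rw [bernExp_ite_apply]
    rw [Finset.mem_erase] at hu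
    exact hr _ (mk_mem_pairsWithin.2 ⟨hv, hu.2, hu.1.symm⟩)
  rw [hsum] at hcompl
  change bernProb r (D v)ᶜ ≤ _ at hcompl
  rw [bernProb_compl] at hcompl
  have : 1 / ((t : ℝ) + 1) * (y * ((S.card : ℝ) - 1)) ≤ 1 / ((t : ℝ) + 1) * t :=
    mul_le_mul_of_nonneg_left ht (by positivity)
  have : 1 / ((t : ℝ) + 1) * t = 1 - 1 / ((t : ℝ) + 1) := by field_simp; ring
  linarith

/-- Change of measure: lower bound for the probability that `S` has maximum degree at most `t`,
where the density of `S` is tilted from `p` down to `y`. -/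
lemma le_bernProb_degLE {p y η : ℝ} (hp1 : p < 1) (hy0 : 0 < y) (hyp : y ≤ p)
    (hη0 : 0 ≤ η) (hη1 : η ≤ 1) {t : ℕ} {S : Finset V} (ht : y * ((S.card : ℝ) - 1) ≤ t) :
    Real.exp (-(S.card.choose 2 * (LambdaStar p y +
        η * Real.log (p * (1 - y) / (y * (1 - p)))))) *
      ((1 / ((t : ℝ) + 1)) ^ S.card - Real.exp (-(η ^ 2 / 4 * S.card.choose 2))) ≤
    bernProb (fun _ => p) (degLE t S (pairsWithin S)) := by
  set F := pairsWithin S with hF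
  set A := degLE t S F with hA
  set θ := Real.log (p * (1 - y) / (y * (1 - p))) with hθ
  set N : ℝ := (S.card.choose 2 : ℝ) with hN
  have hNF : (F.card : ℝ) = N := by rw [hF, card_pairsWithin]
  have hp0 : 0 < p := hy0.trans_le hyp
  have hq : 0 < 1 - p := by linarith
  have hy' : 0 < 1 - y := by linarith
  let r : Sym2 V → ℝ := fun e => if e ∈ F then y else p
  have h0 : ∀ e, 0 ≤ r e := fun e => by
    change 0 ≤ ite _ _ _
    split_ifs <;> linarith
  have h1 : ∀ e, r e ≤ 1 := fun e => by
    change ite _ _ _ ≤ 1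
    split_ifs <;> linarith
  have hr : ∀ e ∈ F, r e = y := fun e he => if_pos he
  have hθ0 : 0 ≤ θ := Real.log_nonneg ((one_le_div (by positivity)).2 (by nlinarith))
  have hθeq : θ = Real.log p + Real.log (1 - y) - (Real.log y + Real.log (1 - p)) := by
    rw [hθ, Real.log_div (by positivity) (by positivity), Real.log_mul hp0.ne' hy'.ne',
      Real.log_mul hy0.ne' hq.ne']
  have hΛ : LambdaStar p y = y * (Real.log y - Real.log p) +
      (1 - y) * (Real.log (1 - y) - Real.log (1 - p)) := by
    rw [LambdaStar, Real.log_div hy0.ne' hp0.ne', Real.log_div hy'.ne' hq.ne']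
  have htrue : y * Real.exp (-LambdaStar p y + θ * (1 - y)) = p := by
    have : -LambdaStar p y + θ * (1 - y) = Real.log p - Real.log y := by rw [hΛ, hθeq]; ring
    rw [this, Real.exp_sub, Real.exp_log hp0, Real.exp_log hy0]
    field_simp
  have hfalse : (1 - y) * Real.exp (-LambdaStar p y + θ * (0 - y)) = 1 - p := by
    have : -LambdaStar p y + θ * (0 - y) = Real.log (1 - p) - Real.log (1 - y) := by
      rw [hΛ, hθeq]; ring
    rw [this, Real.exp_sub, Real.exp_log hq, Real.exp_log hy']
    field_simp
  have hweight : ∀ f : Sym2 V → Bool, bernWeight (fun _ => p) f = bernWeight r f *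
      Real.exp (-(N * LambdaStar p y) + θ * ((F.filter fun e => f e = true).card - y * N)) := by
    intro f
    have hsum : -(N * LambdaStar p y) + θ * ((F.filter fun e => f e = true).card - y * N) =
        ∑ e ∈ F, (-LambdaStar p y + θ * ((if f e = true then (1 : ℝ) else 0) - y)) := by
      rw [Finset.sum_add_distrib, ← Finset.mul_sum, Finset.sum_sub_distrib, Finset.sum_boole,
        Finset.sum_const, Finset.sum_const, nsmul_eq_mul, nsmul_eq_mul, hNF]
      ring
    rw [hsum, Real.exp_sum, bernWeight, bernWeight]
    have hsub : ∏ e ∈ F, Real.exp (-LambdaStar p y +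
        θ * ((if f e = true then (1 : ℝ) else 0) - y)) = ∏ e, if e ∈ F then
        Real.exp (-LambdaStar p y + θ * ((if f e = true then (1 : ℝ) else 0) - y)) else 1 := by
      rw [← Finset.prod_filter]
      exact Finset.prod_congr (by ext; simp) fun _ _ => rfl
    rw [hsub, ← Finset.prod_mul_distrib]
    refine Finset.prod_congr rfl fun e _ => ?_
    by_cases he : e ∈ F
    · by_cases hfe : f e = true <;> simp only [he, hfe, r, if_true, if_false, Bool.false_eq_true]
      · exact htrue.symm
      · exact hfalse.symm
    · simp [he, r]
  set L := {f : Sym2 V → Bool | ((F.filter fun e => f e = true).card : ℝ) < (y - η) * F.card}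
    with hL
  have hmain : Real.exp (-(N * (LambdaStar p y + η * θ))) * bernProb r (A \ L) ≤
      bernProb (fun _ => p) A := by
    rw [bernProb, ← bernExp_const_mul, bernProb, bernExp, bernExp]
    refine Finset.sum_le_sum fun f _ => ?_
    rw [hweight f, mul_assoc]
    refine mul_le_mul_of_nonneg_left ?_ (bernWeight_nonneg h0 h1 f)
    by_cases hf : f ∈ A \ L
    · rw [Set.indicator_of_mem hf, Set.indicator_of_mem hf.1, Pi.one_apply, mul_one, mul_one]
      refine Real.exp_le_exp.2 ?_
      have h2 : (y - η) * N ≤ (F.filter fun e => f e = true).card := by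
        rw [← hNF]
        exact not_lt.1 hf.2
      nlinarith [mul_le_mul_of_nonneg_left h2 hθ0]
    · rw [Set.indicator_of_notMem hf, mul_zero]
      exact mul_nonneg (Real.exp_pos _).le (Set.indicator_nonneg (fun _ _ => zero_le_one) f)
  refine le_trans (mul_le_mul_of_nonneg_left ?_ (Real.exp_pos _).le) hmain
  have e₁ := prod_le_bernProb_degLE h0 h1 hr ht
  have e₂ : bernProb r L ≤ Real.exp (-(η ^ 2 / 4 * N)) := by
    rw [← hNF]
    exact bernProb_card_lt_le h0 h1 hy0.le (by linarith) hr hη0 hη1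
  have e₃ := bernProb_inter_add_diff r A L
  have e₄ := bernProb_mono h0 h1 (Set.inter_subset_right : A ∩ L ⊆ L)
  linarith

end BoundedDegree

section SecondMoment

lemma choose_sub_mul_pow_le {n k : ℕ} (hkn : k ≤ n) (l : ℕ) (hl : l ≤ k) :
    (n - l).choose (k - l) * n ^ l ≤ n.choose k * k ^ l := by
  induction l with
  | zero => simp
  | succ l ih =>
    have hlk : l < k := hl
    have h := Nat.add_one_mul_choose_eq (n - (l + 1)) (k - (l + 1))
    have e₁ : n - (l + 1) + 1 = n - l := by omega
    have e₂ : k - (l + 1) + 1 = k - l := by omega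
    rw [e₁, e₂] at h
    have hfrac : (k - l) * n ≤ k * (n - l) := by
      zify [hlk.le, hlk.le.trans hkn]
      have : (k : ℤ) ≤ n := by exact_mod_cast hkn
      nlinarith [mul_nonneg (sub_nonneg.2 this) (Int.natCast_nonneg l)]
    refine Nat.le_of_mul_le_mul_left ?_ (by omega : 0 < n - l)
    calc (n - l) * ((n - (l + 1)).choose (k - (l + 1)) * n ^ (l + 1))
        = ((n - l) * (n - (l + 1)).choose (k - (l + 1))) * n ^ (l + 1) := by ring
      _ = ((n - l).choose (k - l) * n ^ l) * ((k - l) * n) := by rw [h]; ring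
      _ ≤ (n.choose k * k ^ l) * (k * (n - l)) := Nat.mul_le_mul (ih hlk.le) hfrac
      _ = (n - l) * (n.choose k * k ^ (l + 1)) := by ring

variable {V : Type*} [Fintype V] [DecidableEq V]

lemma card_powersetCard_filter_subset_le (k : ℕ) (U : Finset V) :
    ((Finset.powersetCard k (Finset.univ : Finset V)).filter fun T => U ⊆ T).card ≤
      (Fintype.card V - U.card).choose (k - U.card) := by
  rw [← Finset.card_compl, ← Finset.card_powersetCard]
  refine Finset.card_le_card_of_injOn (fun T => T \ U) (fun T hT => ?_) fun T hT T' hT' h => ?_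
  · have hT := Finset.mem_filter.1 (Finset.mem_coe.1 hT)
    rw [Finset.mem_coe, Finset.mem_powersetCard]
    refine ⟨fun x hx => Finset.mem_compl.2 (Finset.mem_sdiff.1 hx).2, ?_⟩
    rw [Finset.card_sdiff_of_subset hT.2, (Finset.mem_powersetCard.1 hT.1).2]
  · have hT := Finset.mem_filter.1 (Finset.mem_coe.1 hT)
    have hT' := Finset.mem_filter.1 (Finset.mem_coe.1 hT')
    rw [← Finset.sdiff_union_of_subset hT.2, ← Finset.sdiff_union_of_subset hT'.2]
    exact congrArg (· ∪ U) h

/-- The number of `k`-sets meeting a given `k`-set in exactly `l` points. -/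
lemma card_filter_card_inter_eq_mul_le {k l : ℕ} (hkn : k ≤ Fintype.card V) (hl : l ≤ k)
    {S : Finset V} (hS : S.card = k) :
    ((Finset.powersetCard k (Finset.univ : Finset V)).filter fun T => (S ∩ T).card = l).card *
      Fintype.card V ^ l ≤ (Fintype.card V).choose k * (k ^ 2) ^ l := by
  have hsub : ((Finset.powersetCard k (Finset.univ : Finset V)).filter
      fun T => (S ∩ T).card = l) ⊆ (Finset.powersetCard l S).biUnion fun U =>
        (Finset.powersetCard k (Finset.univ : Finset V)).filter fun T => U ⊆ T := by
    intro T hT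
    rw [Finset.mem_filter] at hT
    exact Finset.mem_biUnion.2 ⟨S ∩ T, Finset.mem_powersetCard.2
      ⟨Finset.inter_subset_left, hT.2⟩, Finset.mem_filter.2 ⟨hT.1, Finset.inter_subset_right⟩⟩
  have hcard := (Finset.card_le_card hsub).trans (Finset.card_biUnion_le_card_mul _ _
    ((Fintype.card V - l).choose (k - l)) fun U hU => by
      rw [← (Finset.mem_powersetCard.1 hU).2]
      exact card_powersetCard_filter_subset_le k U)
  rw [Finset.card_powersetCard, hS] at hcard
  calc _ ≤ k.choose l * (Fintype.card V - l).choose (k - l) * Fintype.card V ^ l :=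
        Nat.mul_le_mul_right _ hcard
    _ = k.choose l * ((Fintype.card V - l).choose (k - l) * Fintype.card V ^ l) := by ring
    _ ≤ k ^ l * ((Fintype.card V).choose k * k ^ l) :=
        Nat.mul_le_mul (Nat.choose_le_pow k l) (choose_sub_mul_pow_le hkn l hl)
    _ = _ := by rw [← pow_mul]; ring

/-- If overlapping pairs of `k`-sets contribute little to the second moment, then with very high
probability some `k`-set has maximum degree at most `t`. -/
lemma bernProb_no_degLE_le {p : ℝ} (hp0 : 0 ≤ p) (hp1 : p < 1) {t k : ℕ} (hk : 2 ≤ k)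
    (hkn : k ≤ Fintype.card V) {C : ℝ} (hC : 0 < C)
    (hratio : ∀ T U : Finset V, T.card = k → U ⊆ T → 2 ≤ U.card →
      ((k : ℝ) ^ 2 / Fintype.card V) ^ U.card *
          bernProb (fun _ => p) (degLE t T (pairsWithin T \ pairsWithin U)) ≤
        C * ((k : ℝ) ^ 4 / (Fintype.card V : ℝ) ^ 2) *
          bernProb (fun _ => p) (degLE t T (pairsWithin T))) :
    bernProb (fun _ => p) {f | ∀ S : Finset V, S.card = k → f ∉ degLE t S (pairsWithin S)} ≤
      Real.exp (-((Fintype.card V : ℝ) ^ 2 / (2 * C * (k : ℝ) ^ 5))) := by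
  set n := Fintype.card V with hn
  have h0 : ∀ _ : Sym2 V, 0 ≤ p := fun _ => hp0
  have h1 : ∀ _ : Sym2 V, p ≤ 1 := fun _ => hp1.le
  let sets := Finset.powersetCard k (Finset.univ : Finset V)
  let P : Finset V → ℝ := fun S => bernProb (fun _ => p) (degLE t S (pairsWithin S))
  have hn0 : (0 : ℝ) < n := by
    have : 0 < n := by omega
    exact_mod_cast this
  have hk0 : (0 : ℝ) < k := by
    have : 0 < k := by omega
    exact_mod_cast this
  obtain ⟨S₀, -, hS₀⟩ := Finset.exists_subset_card_eq (s := (Finset.univ : Finset V)) hkn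
  set a := P S₀ with ha
  have hPa : ∀ S ∈ sets, P S = a := fun S hS =>
    bernProb_degLE_eq_of_card_eq p t ((Finset.mem_powersetCard.1 hS).2.trans hS₀.symm)
  have ha0 : 0 < a := by
    have h := bernProb_degLE_sdiff_mul_le h0 h1 t S₀ (pairsWithin S₀) (pairsWithin S₀)
    have htriv : degLE t S₀ (∅ : Finset (Sym2 V)) = Set.univ := by
      ext f
      simp [degLE]
    rw [sdiff_self, Finset.bot_eq_empty, htriv, bernProb_univ, one_mul] at h
    exact (Finset.prod_pos fun _ _ => sub_pos.2 hp1).trans_le h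
  set μ : ℝ := n.choose k * a with hμ
  have hsumP : ∑ S ∈ sets, P S = μ := by
    rw [Finset.sum_congr rfl hPa, Finset.sum_const, Finset.card_powersetCard, Finset.card_univ,
      nsmul_eq_mul]
  have hμ0 : 0 < μ := mul_pos (by exact_mod_cast Nat.choose_pos hkn) ha0
  set Δ : ℝ := μ ^ 2 * (C * (k ^ 5 / (n : ℝ) ^ 2)) with hΔ
  have hinner : ∀ S ∈ sets, (∑ T ∈ sets, if ¬ Disjoint (pairsWithin S) (pairsWithin T) then
      bernProb (fun _ => p) (degLE t S (pairsWithin S) ∩ degLE t T (pairsWithin T)) else 0) ≤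
      P S * (μ * (C * (k ^ 5 / (n : ℝ) ^ 2))) := by
    intro S hS
    have hSk := (Finset.mem_powersetCard.1 hS).2
    have hterm : ∀ T ∈ sets, (if ¬ Disjoint (pairsWithin S) (pairsWithin T) then
        bernProb (fun _ => p) (degLE t S (pairsWithin S) ∩ degLE t T (pairsWithin T)) else 0) ≤
        P S * ∑ l ∈ Finset.Icc 2 k, if (S ∩ T).card = l then
          C * ((k : ℝ) ^ 4 / (n : ℝ) ^ 2) * a * ((n : ℝ) / k ^ 2) ^ l else 0 := by
      intro T hT
      have hTk := (Finset.mem_powersetCard.1 hT).2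
      have hP0 := bernProb_nonneg h0 h1 (degLE t S (pairsWithin S))
      split_ifs with hdis
      · refine mul_nonneg hP0 (Finset.sum_nonneg fun l _ => ?_)
        split_ifs <;> positivity
      · refine (bernProb_degLE_inter_le h0 h1 t S T).trans (mul_le_mul_of_nonneg_left ?_ hP0)
        have h2 : 2 ≤ (S ∩ T).card := by
          rw [Finset.disjoint_iff_inter_eq_empty, ← pairsWithin_inter, ← Finset.card_eq_zero,
            card_pairsWithin] at hdis
          by_contra hlt
          exact hdis (Nat.choose_eq_zero_of_lt (not_le.1 hlt))
        have hlk : (S ∩ T).card ≤ k := hSk ▸ Finset.card_le_card Finset.inter_subset_left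
        rw [Finset.sum_ite_eq, if_pos (Finset.mem_Icc.2 ⟨h2, hlk⟩)]
        have h := hratio T (S ∩ T) hTk Finset.inter_subset_right h2
        rw [show bernProb (fun _ => p) (degLE t T (pairsWithin T)) = a from hPa T hT] at h
        have hinv : ((k : ℝ) ^ 2 / n) ^ (S ∩ T).card * ((n : ℝ) / k ^ 2) ^ (S ∩ T).card = 1 := by
          rw [← mul_pow, div_mul_div_comm, mul_comm, div_self (by positivity), one_pow]
        calc _ = ((k : ℝ) ^ 2 / n) ^ (S ∩ T).card * bernProb (fun _ => p)
                (degLE t T (pairsWithin T \ pairsWithin (S ∩ T))) *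
                ((n : ℝ) / k ^ 2) ^ (S ∩ T).card := by
              rw [mul_right_comm, hinv, one_mul]
          _ ≤ _ := mul_le_mul_of_nonneg_right h (by positivity)
    refine (Finset.sum_le_sum hterm).trans ?_
    rw [← Finset.mul_sum, Finset.sum_comm]
    refine mul_le_mul_of_nonneg_left ?_ (bernProb_nonneg h0 h1 _)
    have hlbound : ∀ l ∈ Finset.Icc 2 k, (∑ T ∈ sets, if (S ∩ T).card = l then
        C * ((k : ℝ) ^ 4 / (n : ℝ) ^ 2) * a * ((n : ℝ) / k ^ 2) ^ l else 0) ≤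
        C * ((k : ℝ) ^ 4 / (n : ℝ) ^ 2) * μ := by
      intro l hl
      rw [← Finset.sum_filter, Finset.sum_const, nsmul_eq_mul]
      have hcount : (((sets.filter fun T => (S ∩ T).card = l).card : ℝ)) * (n : ℝ) ^ l ≤
          n.choose k * ((k : ℝ) ^ 2) ^ l := by
        exact_mod_cast card_filter_card_inter_eq_mul_le hkn (Finset.mem_Icc.1 hl).2 hSk
      rw [div_pow]
      calc _ = C * ((k : ℝ) ^ 4 / (n : ℝ) ^ 2) * a *
            (((sets.filter fun T => (S ∩ T).card = l).card : ℝ) * (n : ℝ) ^ l /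
              ((k : ℝ) ^ 2) ^ l) := by
            ring
        _ ≤ C * ((k : ℝ) ^ 4 / (n : ℝ) ^ 2) * a * n.choose k := by
            refine mul_le_mul_of_nonneg_left ?_ (by positivity)
            exact (div_le_iff₀ (by positivity)).2 hcount
        _ = _ := by rw [hμ]; ring
    refine (Finset.sum_le_sum hlbound).trans ?_
    rw [Finset.sum_const, nsmul_eq_mul, Nat.card_Icc]
    have hc : ((k + 1 - 2 : ℕ) : ℝ) ≤ k := by
      have : k + 1 - 2 ≤ k := by omega
      exact_mod_cast this
    calc _ ≤ (k : ℝ) * (C * ((k : ℝ) ^ 4 / (n : ℝ) ^ 2) * μ) :=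
          mul_le_mul_of_nonneg_right hc (by positivity)
      _ = _ := by ring
  have hpairs : (∑ S : sets, ∑ T : sets, if ¬ Disjoint (pairsWithin S.1) (pairsWithin T.1) then
      bernProb (fun _ => p) (degLE t S.1 (pairsWithin S.1) ∩ degLE t T.1 (pairsWithin T.1))
      else 0) ≤ Δ := by
    have h : ∀ S : sets, (∑ T : sets, if ¬ Disjoint (pairsWithin S.1) (pairsWithin T.1) then
        bernProb (fun _ => p) (degLE t S.1 (pairsWithin S.1) ∩ degLE t T.1 (pairsWithin T.1))
        else 0) ≤ P S.1 * (μ * (C * (k ^ 5 / (n : ℝ) ^ 2))) := fun S => by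
      rw [Finset.sum_coe_sort sets fun T => if ¬ Disjoint (pairsWithin S.1) (pairsWithin T) then
        bernProb (fun _ => p) (degLE t S.1 (pairsWithin S.1) ∩ degLE t T (pairsWithin T)) else 0]
      exact hinner S.1 S.2
    refine (Finset.sum_le_sum fun S _ => h S).trans_eq ?_
    rw [← Finset.sum_mul, Finset.sum_coe_sort sets P, hsumP, hΔ]
    ring
  have hsumP' : ∑ S : sets, bernProb (fun _ => p) (degLE t S.1 (pairsWithin S.1)) = μ := by
    rw [← hsumP]
    exact Finset.sum_coe_sort sets P
  have hμΔ : μ ≤ Δ := by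
    rw [← hsumP']
    refine le_trans (Finset.sum_le_sum fun S _ => ?_) hpairs
    have hnd : ¬ Disjoint (pairsWithin S.1) (pairsWithin S.1) := by
      rw [disjoint_self, Finset.bot_eq_empty, ← Finset.card_eq_zero, card_pairsWithin,
        (Finset.mem_powersetCard.1 S.2).2]
      exact (Nat.choose_pos hk).ne'
    refine le_trans (le_of_eq ?_) (Finset.single_le_sum (fun T _ => ?_) (Finset.mem_univ S))
    · rw [if_pos hnd, Set.inter_self]
    · split_ifs
      exacts [le_rfl, bernProb_nonneg h0 h1 _]
  have hJ := bernProb_avoid_le (ι := sets) h0 h1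
    (A := fun S => degLE t S.1 (pairsWithin S.1)) (F := fun S => pairsWithin S.1)
    (fun S => isLowerSet_degLE t S.1 _) (fun S => dependsOn_degLE t S.1 _)
    (hμ0.trans_le hμΔ) (hsumP'.trans_le hμΔ) hpairs
  rw [hsumP'] at hJ
  refine (bernProb_mono h0 h1 fun f hf => ?_).trans (hJ.trans_eq ?_)
  · exact Set.mem_iInter.2 fun S => hf S.1 (Finset.mem_powersetCard.1 S.2).2
  · congr 2
    rw [hΔ]
    field_simp

end SecondMoment

section Asymptotics

lemma Real.log_mul_div_mul_nonneg {p y : ℝ} (hp1 : p < 1) (hy : 0 < y) (hyp : y < p) :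
    0 ≤ Real.log (p * (1 - y) / (y * (1 - p))) := by
  refine Real.log_nonneg ((one_le_div (mul_pos hy (sub_pos.2 hp1))).2 ?_)
  nlinarith

lemma LambdaStar_zero (p : ℝ) : LambdaStar p 0 = -Real.log (1 - p) := by
  simp [LambdaStar]

lemma LambdaStar_eq_neg {p y : ℝ} (hp1 : p < 1) (hy : 0 < y) (hyp : y < p) :
    LambdaStar p y =
      -(y * Real.log (p * (1 - y) / (y * (1 - p))) + Real.log ((1 - p) / (1 - y))) := by
  have hq := (sub_pos.2 hp1).ne'
  have hy1 := (sub_pos.2 (hyp.trans hp1)).ne'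
  have hp := (hy.trans hyp).ne'
  rw [LambdaStar, Real.log_div hy.ne' hp, Real.log_div hy1 hq,
    Real.log_div (mul_ne_zero hp hy1) (mul_ne_zero hy.ne' hq), Real.log_mul hp hy1,
    Real.log_mul hy.ne' hq, Real.log_div hq hy1]
  ring

lemma eventually_exp_le_inv_pow_sub {a : ℝ} (ha : 0 < a) :
    ∀ᶠ k : ℕ in atTop, Real.exp (-(a * (k : ℝ) ^ 2)) ≤
      (1 / ((k : ℝ) + 1)) ^ k - Real.exp (-(a * (k : ℝ) ^ 2)) := by
  have hlog : ∀ᶠ k : ℕ in atTop, Real.log ((k : ℝ) + 1) ≤ a / 4 * ((k : ℝ) + 1) := by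
    have h := (Real.isLittleO_log_id_atTop.bound (by positivity : 0 < a / 4)).and
      (eventually_ge_atTop 1)
    have hT : Tendsto (fun k : ℕ => (k : ℝ) + 1) atTop atTop :=
      tendsto_atTop_add_const_right _ _ tendsto_natCast_atTop_atTop
    filter_upwards [hT.eventually h] with k hk
    rw [id, Real.norm_of_nonneg (Real.log_nonneg hk.2),
      Real.norm_of_nonneg (zero_le_one.trans hk.2)] at hk
    exact hk.1
  filter_upwards [hlog, tendsto_natCast_atTop_atTop.eventually_ge_atTop (2 / a),
    eventually_ge_atTop 1] with k hk hka hk1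
  have hk1' : (1 : ℝ) ≤ k := by exact_mod_cast hk1
  have hka' : 2 ≤ a * k := by rwa [div_le_iff₀' ha] at hka
  have hx : (k : ℝ) * Real.log ((k : ℝ) + 1) + 1 ≤ a * (k : ℝ) ^ 2 := by
    nlinarith [mul_le_mul_of_nonneg_left hk (by positivity : (0 : ℝ) ≤ k),
      mul_le_mul hka' hk1' zero_le_one (by positivity)]
  have hpow : (1 / ((k : ℝ) + 1)) ^ k = Real.exp (-(k * Real.log ((k : ℝ) + 1))) := by
    rw [one_div, inv_pow, Real.exp_neg, Real.exp_nat_mul, Real.exp_log (by positivity)]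
  have h2 : 2 * Real.exp (-(a * (k : ℝ) ^ 2)) ≤ (1 / ((k : ℝ) + 1)) ^ k := by
    calc 2 * Real.exp (-(a * (k : ℝ) ^ 2)) ≤ Real.exp 1 * Real.exp (-(a * (k : ℝ) ^ 2)) := by
          gcongr
          linarith [Real.add_one_le_exp 1]
      _ ≤ _ := by
          rw [← Real.exp_add, hpow, Real.exp_le_exp]
          linarith
  linarith

variable {p y : ℝ}

/-- A lower bound for the probability that a large `k`-set has maximum degree at most `y (k - 1)`,
with the exact exponential rate. -/
lemma exists_exp_le_bernProb_degLE (hp0 : 0 < p) (hp1 : p < 1) (hy0 : 0 ≤ y) (hyp : y < p) {η : ℝ}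
    (hη : 0 < η) :
    ∃ K : ℕ, ∀ {V : Type} [Fintype V] [DecidableEq V] (S : Finset V), K ≤ S.card →
      Real.exp (-(S.card.choose 2 * LambdaStar p y + η * (S.card : ℝ) ^ 2)) ≤
        bernProb (fun _ => p) (degLE ⌈y * ((S.card : ℝ) - 1)⌉₊ S (pairsWithin S)) := by
  have hq : 0 < 1 - p := sub_pos.2 hp1
  rcases hy0.eq_or_lt with rfl | hy
  · refine ⟨0, fun {V} _ _ S _ => ?_⟩
    have h := bernProb_degLE_sdiff_mul_le (fun _ : Sym2 V => hp0.le) (fun _ => hp1.le)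
      ⌈(0 : ℝ) * ((S.card : ℝ) - 1)⌉₊ S (pairsWithin S) (pairsWithin S)
    have htriv : ∀ t, degLE t S (∅ : Finset (Sym2 V)) = Set.univ := fun t => by
      ext f
      simp [degLE]
    rw [sdiff_self, Finset.bot_eq_empty, htriv, bernProb_univ, one_mul, Finset.prod_const,
      card_pairsWithin] at h
    refine le_trans ?_ h
    rw [← Real.exp_log hq, ← Real.exp_nat_mul, Real.exp_le_exp, LambdaStar_zero]
    nlinarith [mul_nonneg hη.le (sq_nonneg (S.card : ℝ))]
  · set θ := Real.log (p * (1 - y) / (y * (1 - p)))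
    have hθ : 0 ≤ θ := Real.log_mul_div_mul_nonneg hp1 hy hyp
    set s := min 1 (η / (θ + 1)) with hs
    have hs0 : 0 < s := lt_min one_pos (by positivity)
    have hs1 : s ≤ 1 := min_le_left _ _
    have hsθ : s * θ ≤ η := by
      have : s * (θ + 1) ≤ η := (le_div_iff₀ (by positivity)).1 (min_le_right _ _)
      nlinarith
    set a := min (s ^ 2 / 16) (η / 2)
    have ha0 : 0 < a := lt_min (by positivity) (by positivity)
    obtain ⟨K, hK⟩ := eventually_atTop.1 (eventually_exp_le_inv_pow_sub ha0)
    refine ⟨max K 2, fun {V} _ _ S hS => ?_⟩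
    set k := S.card
    have hk2 : (2 : ℝ) ≤ k := by exact_mod_cast (le_max_right K 2).trans hS
    have hkK := hK k ((le_max_left _ _).trans hS)
    have hN : ((k.choose 2 : ℕ) : ℝ) = k * (k - 1) / 2 := Nat.cast_choose_two ℝ k
    have htk : (⌈y * ((k : ℝ) - 1)⌉₊ : ℝ) ≤ k := by
      have : ⌈y * ((k : ℝ) - 1)⌉₊ ≤ k := Nat.ceil_le.2 (by nlinarith)
      exact_mod_cast this
    refine le_trans ?_ (le_bernProb_degLE hp1 hy hyp.le hs0.le hs1
      (Nat.le_ceil (y * ((k : ℝ) - 1))))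
    have h1 : Real.exp (-(η / 2 * (k : ℝ) ^ 2)) ≤
        (1 / ((⌈y * ((k : ℝ) - 1)⌉₊ : ℝ) + 1)) ^ k -
          Real.exp (-(s ^ 2 / 4 * (k.choose 2 : ℕ))) := by
      calc Real.exp (-(η / 2 * (k : ℝ) ^ 2)) ≤ Real.exp (-(a * (k : ℝ) ^ 2)) := by
            have := min_le_right (s ^ 2 / 16) (η / 2)
            gcongr
        _ ≤ _ := hkK
        _ ≤ _ := by
            refine sub_le_sub ?_ (Real.exp_le_exp.2 (neg_le_neg ?_))
            · gcongr
            · have := min_le_left (s ^ 2 / 16) (η / 2)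
              rw [hN]
              nlinarith [mul_le_mul_of_nonneg_right this (sq_nonneg (k : ℝ)),
                mul_nonneg (sq_nonneg s) (mul_nonneg (by linarith : (0 : ℝ) ≤ k)
                  (sub_nonneg.2 hk2))]
    refine le_trans ?_ (mul_le_mul_of_nonneg_left h1 (Real.exp_pos _).le)
    rw [← Real.exp_add, Real.exp_le_exp, hN]
    nlinarith [mul_le_mul_of_nonneg_left hsθ (mul_nonneg (by linarith : (0 : ℝ) ≤ k)
      (by linarith : (0 : ℝ) ≤ (k : ℝ) - 1)), mul_nonneg hη.le (by linarith : (0 : ℝ) ≤ k)]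

lemma exists_bernProb_degLE_sdiff_le_exp (hp0 : 0 < p) (hp1 : p < 1) (hy0 : 0 ≤ y) (hyp : y < p) :
    ∃ C : ℝ, ∀ {V : Type} [Fintype V] [DecidableEq V] (T U : Finset V), U ⊆ T → 1 ≤ T.card →
      bernProb (fun _ => p)
          (degLE ⌈y * ((T.card : ℝ) - 1)⌉₊ T (pairsWithin T \ pairsWithin U)) ≤
        Real.exp (-(((T.card : ℝ) - 1) * ((T.card : ℝ) - U.card) / 2 * LambdaStar p y) +
          C * T.card) := by
  have hq : 0 < 1 - p := sub_pos.2 hp1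
  rcases hy0.eq_or_lt with rfl | hy
  · refine ⟨0, fun {V} _ _ T U hUT hT => ?_⟩
    have h := bernProb_degLE_sdiff_le hp0.le hp1.le le_rfl zero_le_one
      ⌈(0 : ℝ) * ((T.card : ℝ) - 1)⌉₊ T U
    rw [zero_mul, Nat.ceil_zero, zero_mul, pow_zero, one_mul] at h
    rw [zero_mul, Nat.ceil_zero]
    refine h.trans_eq ?_
    rw [zero_pow two_ne_zero, mul_zero, add_zero, ← Real.exp_log (Real.sqrt_pos.2 hq),
      Real.log_sqrt hq.le, ← Real.exp_nat_mul, LambdaStar_zero, Finset.card_sdiff_of_subset hUT]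
    push_cast [Finset.card_le_card hUT, hT]
    congr 1
    ring
  · set θ := Real.log (p * (1 - y) / (y * (1 - p))) with hθdef
    have hθ : 0 ≤ θ := Real.log_mul_div_mul_nonneg hp1 hy hyp
    have hy1 : 0 < 1 - y := sub_pos.2 (hyp.trans hp1)
    refine ⟨θ / 2, fun {V} _ _ T U hUT hT => ?_⟩
    set t := ⌈y * ((T.card : ℝ) - 1)⌉₊
    have hT' : (1 : ℝ) ≤ T.card := by exact_mod_cast hT
    have ht : (t : ℝ) ≤ y * ((T.card : ℝ) - 1) + 1 :=
      (Nat.ceil_lt_add_one (mul_nonneg hy.le (sub_nonneg.2 hT'))).le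
    have h := bernProb_degLE_sdiff_le hp0.le hp1.le (Real.exp_pos (-(θ / 2))).le
      (Real.exp_le_one_iff.2 (by linarith)) t T U
    have hρ : 1 - p + p * Real.exp (-(θ / 2)) ^ 2 = (1 - p) / (1 - y) := by
      rw [← Real.exp_nat_mul, show ((2 : ℕ) : ℝ) * -(θ / 2) = -θ by push_cast; ring,
        Real.exp_neg, hθdef, Real.exp_log (by positivity)]
      field_simp
      ring
    have hm : (((T \ U).card : ℕ) : ℝ) = T.card - U.card := by
      rw [Finset.card_sdiff_of_subset hUT, Nat.cast_sub (Finset.card_le_card hUT)]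
    have hm0 : (0 : ℝ) ≤ T.card - U.card := hm ▸ Nat.cast_nonneg _
    rw [hρ, ← Real.exp_log (Real.sqrt_pos.2 (div_pos hq hy1)), Real.log_sqrt (div_pos hq hy1).le,
      ← Real.exp_nat_mul, ← Real.exp_nat_mul, ← le_div_iff₀' (Real.exp_pos _), ← Real.exp_sub] at h
    refine h.trans (Real.exp_le_exp.2 ?_)
    rw [LambdaStar_eq_neg hp1 hy hyp]
    push_cast [hT]
    rw [hm]
    have h1 := mul_le_mul_of_nonneg_left ht (mul_nonneg hθ hm0)
    have h2 := mul_nonneg hθ (Nat.cast_nonneg (α := ℝ) U.card)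
    rw [← hθdef]
    nlinarith

end Asymptotics

section OverlapRatio

variable {p y : ℝ}

lemma eventually_mul_sq_le_exp (A : ℝ) {a : ℝ} (ha : 0 < a) :
    ∀ᶠ L : ℝ in atTop, A * L ^ 2 ≤ Real.exp (a * L) := by
  have h := (isLittleO_pow_exp_pos_mul_atTop 2 ha).bound (by positivity : 0 < 1 / (|A| + 1))
  filter_upwards [h] with L hL
  rw [Real.norm_of_nonneg (sq_nonneg L), Real.norm_of_nonneg (Real.exp_pos _).le,
    div_mul_eq_mul_div, one_mul, le_div_iff₀ (by positivity)] at hL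
  nlinarith [mul_le_mul_of_nonneg_right (le_abs_self A) (sq_nonneg L), sq_nonneg L]

lemma overlap_small_le {n k l : ℕ} (hn : 0 < n) {β A B : ℝ} (hl : 2 ≤ l)
    (hβ : (k : ℝ) ^ 2 * Real.exp (β * (l + 1) / 2) ≤ n)
    (hAB : B ≤ Real.exp (β * l.choose 2) * A) (hA : 0 ≤ A) :
    ((k : ℝ) ^ 2 / n) ^ l * B ≤ Real.exp β * ((k : ℝ) ^ 4 / (n : ℝ) ^ 2) * A := by
  have hn' : (0 : ℝ) < n := by exact_mod_cast hn
  obtain ⟨m, rfl⟩ := Nat.exists_eq_add_of_le hl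
  have hexp : Real.exp (β * ((2 + m).choose 2 : ℕ)) =
      Real.exp β * Real.exp (β * ((2 + m : ℕ) + 1) / 2) ^ m := by
    rw [← Real.exp_nat_mul, ← Real.exp_add, Nat.cast_choose_two]
    congr 1
    push_cast
    ring
  calc ((k : ℝ) ^ 2 / n) ^ (2 + m) * B
      ≤ ((k : ℝ) ^ 2 / n) ^ (2 + m) * (Real.exp (β * ((2 + m).choose 2 : ℕ)) * A) :=
        mul_le_mul_of_nonneg_left hAB (by positivity)
    _ = Real.exp β * ((k : ℝ) ^ 4 / (n : ℝ) ^ 2) * A *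
          ((k : ℝ) ^ 2 * Real.exp (β * ((2 + m : ℕ) + 1) / 2) / n) ^ m := by
        rw [hexp, pow_add, div_pow, div_pow, div_pow, mul_pow]
        ring
    _ ≤ Real.exp β * ((k : ℝ) ^ 4 / (n : ℝ) ^ 2) * A * 1 :=
        mul_le_mul_of_nonneg_left
          (pow_le_one₀ (by positivity) ((div_le_one hn').2 hβ)) (by positivity)
    _ = _ := mul_one _

lemma overlap_large_le {k l : ℕ} {L δ β A B : ℝ} (hβ : 0 ≤ β) (hk : 1 ≤ k)
    (hkL : (k : ℝ) ^ 2 ≤ Real.exp (δ / 4 * L)) (hL : 0 ≤ L) (hl : 8 ≤ δ * l)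
    (hAB : B ≤ Real.exp (l * L * (1 - δ / 2)) * A) (hA : 0 ≤ A) :
    ((k : ℝ) ^ 2 / Real.exp L) ^ l * B ≤
      Real.exp β * ((k : ℝ) ^ 4 / Real.exp L ^ 2) * A := by
  have hk' : (1 : ℝ) ≤ k := by exact_mod_cast hk
  calc ((k : ℝ) ^ 2 / Real.exp L) ^ l * B
      ≤ (Real.exp (δ / 4 * L) / Real.exp L) ^ l * (Real.exp (l * L * (1 - δ / 2)) * A) := by
        refine mul_le_mul_of_nonneg ?_ hAB (by positivity) (by positivity)
        gcongr
    _ = Real.exp (-(δ * l / 4 * L)) * A := by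
        rw [← Real.exp_sub, ← Real.exp_nat_mul, ← mul_assoc, ← Real.exp_add]
        congr 2
        ring
    _ ≤ Real.exp (-(2 * L)) * A := by
        gcongr
        linarith
    _ = 1 * (1 / Real.exp L ^ 2) * A := by
        rw [← Real.exp_nat_mul, Real.exp_neg]
        push_cast
        ring
    _ ≤ _ := by
        gcongr
        · exact Real.one_le_exp hβ
        · exact one_le_pow₀ hk'

lemma overlap_exponent_le {k l L κ₀ κ₁ C η : ℝ} (hκ₀ : 0 < κ₀) (hl : 0 ≤ l)
    (hkL : k - 1 ≤ κ₁ * L) (hCk : C * k ≤ η * k ^ 2)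
    (hηk : 2 * (η * k ^ 2) ≤ l * L * ((1 - κ₁ / κ₀) / 2)) :
    -((k - 1) * (k - l) / 2 * (2 / κ₀)) + C * k ≤
      l * L * (1 - (1 - κ₁ / κ₀) / 2) + -(k * (k - 1) / 2 * (2 / κ₀) + η * k ^ 2) := by
  have h : l * ((k - 1) / κ₀) ≤ l * (κ₁ * L / κ₀) := by gcongr
  have hid : -((k - 1) * (k - l) / 2 * (2 / κ₀)) =
      l * ((k - 1) / κ₀) - k * (k - 1) / 2 * (2 / κ₀) := by
    field_simp
    ring
  have hL : l * (κ₁ * L / κ₀) = l * L * (κ₁ / κ₀) := by ring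
  linarith

/-- With `k = ⌈κ₁ log n⌉` for some `κ₁ < κ₀`, all overlaps satisfy the second moment condition. -/
lemma eventually_overlap_le (hp0 : 0 < p) (hp1 : p < 1) (hy0 : 0 ≤ y) (hyp : y < p)
    {κ₀ κ₁ : ℝ} (hκ₁ : 0 < κ₁) (hκ : κ₁ < κ₀) (hΛ : κ₀ / 2 * LambdaStar p y = 1) :
    ∀ᶠ n : ℕ in atTop, ∀ k t : ℕ, k = ⌈κ₁ * Real.log n⌉₊ → t = ⌈y * ((k : ℝ) - 1)⌉₊ →
      2 ≤ k ∧ k ≤ n ∧ (k : ℝ) ≤ 2 * κ₀ * Real.log n ∧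
      ∀ T U : Finset (Fin n), T.card = k → U ⊆ T → 2 ≤ U.card →
        ((k : ℝ) ^ 2 / n) ^ U.card *
            bernProb (fun _ => p) (degLE t T (pairsWithin T \ pairsWithin U)) ≤
          (1 / (1 - p)) * ((k : ℝ) ^ 4 / (n : ℝ) ^ 2) *
            bernProb (fun _ => p) (degLE t T (pairsWithin T)) := by
  have hκ₀ : 0 < κ₀ := hκ₁.trans hκ
  have hq : 0 < 1 - p := sub_pos.2 hp1
  set β := -Real.log (1 - p) with hβdef
  have hβ : 0 < β := neg_pos.2 (Real.log_neg hq (by linarith))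
  have hexpβ : Real.exp β = 1 / (1 - p) := by
    rw [hβdef, Real.exp_neg, Real.exp_log hq, one_div]
  have hΛ' : LambdaStar p y = 2 / κ₀ := by
    field_simp at hΛ ⊢
    linarith
  set δ := 1 - κ₁ / κ₀ with hδdef
  have hδ : 0 < δ := sub_pos.2 ((div_lt_one hκ₀).2 hκ)
  set c := 1 / (2 * κ₀ * β) with hcdef
  have hc : 0 < c := by positivity
  set η := δ * c / (8 * κ₀) with hηdef
  have hη : 0 < η := by positivity
  obtain ⟨K, hK⟩ := exists_exp_le_bernProb_degLE hp0 hp1 hy0 hyp hη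
  obtain ⟨C, hC⟩ := exists_bernProb_degLE_sdiff_le_exp hp0 hp1 hy0 hyp
  have hlog : Tendsto (fun n : ℕ => Real.log n) atTop atTop :=
    Real.tendsto_log_atTop.comp tendsto_natCast_atTop_atTop
  have hL := (eventually_mul_sq_le_exp ((2 * κ₀) ^ 2) (by positivity : 0 < δ / 4)).and <|
    (eventually_mul_sq_le_exp ((2 * κ₀) ^ 2 * Real.exp (β / 2)) one_half_pos).and <|
    (eventually_ge_atTop (1 / κ₀)).and <| (eventually_ge_atTop (2 / κ₁)).and <|
    (eventually_ge_atTop (K / κ₁)).and <| (eventually_ge_atTop (8 / (δ * c) / κ₁)).and <|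
    (eventually_ge_atTop (C / η / κ₁))
  filter_upwards [hlog.eventually hL, eventually_gt_atTop 0] with n hn hn0 k t hk ht
  obtain ⟨hδL, hβL, hL1, hL2, hLK, hL8, hLC⟩ := hn
  set L := Real.log n with hLdef
  have hnL : (n : ℝ) = Real.exp L := (Real.exp_log (by exact_mod_cast hn0)).symm
  have hL0 : 0 < L := (by positivity : 0 < 1 / κ₀).trans_le hL1
  have hkL : κ₁ * L ≤ k := hk ▸ Nat.le_ceil _
  have hkL' : (k : ℝ) - 1 ≤ κ₁ * L := by
    have := (Nat.ceil_lt_add_one (mul_pos hκ₁ hL0).le).le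
    rw [← hk] at this
    linarith
  have hk2 : (2 : ℝ) ≤ k := ((div_le_iff₀' hκ₁).1 hL2).trans hkL
  have hkK : (K : ℝ) ≤ k := ((div_le_iff₀' hκ₁).1 hLK).trans hkL
  have hk8 : 8 / (δ * c) ≤ k := ((div_le_iff₀' hκ₁).1 hL8).trans hkL
  have hkC : C / η ≤ k := ((div_le_iff₀' hκ₁).1 hLC).trans hkL
  have hkκ : (k : ℝ) ≤ 2 * κ₀ * L := by
    have h1 : 1 ≤ κ₀ * L := (div_le_iff₀' hκ₀).1 hL1
    linarith [mul_le_mul_of_nonneg_right hκ.le hL0.le]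
  have hksq : (k : ℝ) ^ 2 ≤ (2 * κ₀) ^ 2 * L ^ 2 := by
    rw [← mul_pow]
    gcongr
  have hk2' : 2 ≤ k := by exact_mod_cast hk2
  have hkβ : (k : ℝ) ^ 2 * Real.exp (β / 2) ≤ Real.exp (1 / 2 * L) := by
    refine le_trans ?_ hβL
    rw [mul_right_comm]
    gcongr
  refine ⟨hk2', ?_, hkκ, fun T U hT hUT hU => ?_⟩
  · have h1 : (k : ℝ) ≤ n := by
      calc (k : ℝ) ≤ (k : ℝ) ^ 2 * 1 :=
          (le_self_pow₀ (one_le_two.trans hk2) two_ne_zero).trans_eq (mul_one _).symm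
        _ ≤ (k : ℝ) ^ 2 * Real.exp (β / 2) := by
            gcongr
            exact Real.one_le_exp (by positivity)
        _ ≤ Real.exp (1 / 2 * L) := hkβ
        _ ≤ Real.exp L := Real.exp_le_exp.2 (by linarith)
        _ = n := hnL.symm
    exact_mod_cast h1
  have h0 : ∀ _ : Sym2 (Fin n), 0 ≤ p := fun _ => hp0.le
  have h1 : ∀ _ : Sym2 (Fin n), p ≤ 1 := fun _ => hp1.le
  set A := bernProb (fun _ => p) (degLE t T (pairsWithin T))
  set B := bernProb (fun _ => p) (degLE t T (pairsWithin T \ pairsWithin U))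
  have hA0 : 0 ≤ A := bernProb_nonneg h0 h1 _
  rw [← hexpβ]
  by_cases hUc : (U.card : ℝ) ≤ c * k
  · refine overlap_small_le hn0 hU ?_ ?_ hA0
    · have hcL : β * (U.card + 1) / 2 ≤ β / 2 + 1 / 2 * L := by
        have : β * (c * k) ≤ L := by
          calc β * (c * k) ≤ β * (c * (2 * κ₀ * L)) := by gcongr
            _ = L := by rw [hcdef]; field_simp
        linarith [mul_le_mul_of_nonneg_left hUc hβ.le]
      calc (k : ℝ) ^ 2 * Real.exp (β * (U.card + 1) / 2)
          ≤ (k : ℝ) ^ 2 * Real.exp (β / 2 + 1 / 2 * L) := by gcongr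
        _ = ((k : ℝ) ^ 2 * Real.exp (β / 2)) * Real.exp (1 / 2 * L) := by
            rw [Real.exp_add]
            ring
        _ ≤ Real.exp (1 / 2 * L) * Real.exp (1 / 2 * L) := by gcongr
        _ = n := by
            rw [← Real.exp_add, hnL]
            congr 1
            ring
    · have h := bernProb_degLE_sdiff_mul_le h0 h1 t T (pairsWithin T) (pairsWithin U)
      rw [Finset.prod_const, card_pairsWithin, ← le_div_iff₀ (by positivity)] at h
      refine h.trans_eq ?_
      rw [mul_comm β, Real.exp_nat_mul, hexpβ, one_div, inv_pow, div_eq_inv_mul]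
  · push Not at hUc
    have hUc8 : 8 ≤ δ * U.card := by
      have h2 : 8 ≤ k * (δ * c) := (div_le_iff₀ (by positivity)).1 hk8
      linarith [mul_le_mul_of_nonneg_left hUc.le hδ.le]
    rw [hnL]
    refine overlap_large_le hβ.le (by omega) (hksq.trans hδL) hL0.le hUc8 ?_ hA0
    have hlow := hK T (by rw [hT]; exact_mod_cast hkK)
    have hup := hC T U hUT (by omega)
    rw [hT, ← ht] at hlow hup
    have hCk : C * k ≤ η * (k : ℝ) ^ 2 := by
      linarith [mul_le_mul_of_nonneg_right ((div_le_iff₀ hη).1 hkC) (Nat.cast_nonneg (α := ℝ) k)]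
    have hηk : 2 * (η * (k : ℝ) ^ 2) ≤ U.card * L * (δ / 2) := by
      calc 2 * (η * (k : ℝ) ^ 2) = (c * k) * (k / (2 * κ₀)) * (δ / 2) := by
            rw [hηdef]
            ring
        _ ≤ U.card * L * (δ / 2) :=
            mul_le_mul_of_nonneg_right (mul_le_mul hUc.le
              ((div_le_iff₀' (mul_pos two_pos hκ₀)).2 hkκ) (div_nonneg (Nat.cast_nonneg _)
                (mul_pos two_pos hκ₀).le) (Nat.cast_nonneg _)) (half_pos hδ).le
    have hexp : -(((k : ℝ) - 1) * ((k : ℝ) - U.card) / 2 * LambdaStar p y) + C * k ≤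
        U.card * L * (1 - δ / 2) + -((k.choose 2 : ℕ) * LambdaStar p y + η * (k : ℝ) ^ 2) := by
      rw [hΛ', Nat.cast_choose_two]
      exact overlap_exponent_le hκ₀ (Nat.cast_nonneg _) hkL' hCk hηk
    calc B ≤ _ := hup
      _ ≤ _ := Real.exp_le_exp.2 hexp
      _ = _ := Real.exp_add _ _
      _ ≤ _ := mul_le_mul_of_nonneg_left hlow (Real.exp_pos _).le

end OverlapRatio

section RandomGraph

lemma bernoulliBool_singleton {p : ℝ} (b : Bool) :
    bernoulliBool p {b} = ENNReal.ofReal (if b then p else 1 - p) := by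
  cases b <;> simp [bernoulliBool, ENNReal.ofReal]

lemma erMeasure_apply {n : ℕ} {p : ℝ} (hp0 : 0 ≤ p) (hp1 : p ≤ 1)
    (s : Set (SimpleGraph (Fin n))) :
    erMeasure n p s = ENNReal.ofReal (bernProb (fun _ => p)
      {f : Sym2 (Fin n) → Bool | SimpleGraph.fromEdgeSet {e | f e = true} ∈ s}) := by
  classical
  have hw : ∀ f : Sym2 (Fin n) → Bool, 0 ≤ bernWeight (fun _ => p) f := fun f =>
    bernWeight_nonneg (fun _ => hp0) (fun _ => hp1) f
  have hsingle : ∀ f : Sym2 (Fin n) → Bool, (Measure.pi fun _ : Sym2 (Fin n) => bernoulliBool p) {f}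
      = ENNReal.ofReal (bernWeight (fun _ => p) f) := fun f => by
    rw [Measure.pi_singleton, bernWeight, ENNReal.ofReal_prod_of_nonneg fun e _ => by
      split_ifs <;> linarith]
    exact Finset.prod_congr rfl fun e _ => bernoulliBool_singleton (f e)
  rw [erMeasure, Measure.map_apply Measurable.of_discrete MeasurableSpace.measurableSet_top]
  set A := {f : Sym2 (Fin n) → Bool | SimpleGraph.fromEdgeSet {e | f e = true} ∈ s}
  change (Measure.pi fun _ : Sym2 (Fin n) => bernoulliBool p) A = _
  rw [← Set.coe_toFinset A, ← sum_measure_singleton, Finset.sum_congr rfl fun f _ => hsingle f,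
    ← ENNReal.ofReal_sum_of_nonneg fun f _ => hw f, bernProb, bernExp]
  congr 1
  rw [← Finset.sum_subset (Finset.subset_univ A.toFinset) fun f _ hf => by
    rw [Set.coe_toFinset, Set.indicator_of_notMem (by simpa using hf), mul_zero]]
  refine Finset.sum_congr rfl fun f hf => ?_
  rw [Set.indicator_of_mem (Finset.mem_coe.2 hf), Pi.one_apply, mul_one]

lemma le_tDependenceNumber {n : ℕ} {f : Sym2 (Fin n) → Bool} {s t : ℕ} (hst : s ≤ t)
    {S : Finset (Fin n)} (hf : f ∈ degLE s S (pairsWithin S)) :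
    S.card ≤ tDependenceNumber (SimpleGraph.fromEdgeSet {e | f e = true}) t := by
  refine le_csSup ⟨n, ?_⟩ ⟨S, Set.ncard_coe_finset S, fun v hv => ?_⟩
  · rintro m ⟨S', rfl, -⟩
    simpa using Set.ncard_le_card S'
  · refine le_trans ?_ ((hf v hv).trans hst)
    rw [← Set.ncard_coe_finset]
    refine Set.ncard_le_ncard (fun u hu => ?_) (Finset.finite_toSet _)
    obtain ⟨huS, hadj⟩ := hu
    rw [SimpleGraph.fromEdgeSet_adj] at hadj
    rw [Finset.mem_coe, Finset.mem_filter, mk_mem_pairsWithin]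
    exact ⟨huS, ⟨hv, huS, hadj.2⟩, hadj.1⟩

end RandomGraph

/-- Fix `0 < p < 1`, `τ ≥ 0`, let `κ₀ = κ_p(τ)` be the unique `κ > τ/p`
with `(κ/2)·Λ*(τ/κ) = 1`, and fix `0 < ε < κ₀`.  If `t(n)/ln n → τ` and
`k(n)/ln n → κ₀ - ε`, then there are `c > 0` and `n₀` such that for all `n ≥ n₀`,
`Pr(α^{t(n)}(G(n,p)) < k(n)) ≤ exp(-c·n²/(ln n)⁵)`. -/
theorem stmt14 (p : ℝ) (hp0 : 0 < p) (hp1 : p < 1) (τ : ℝ) (hτ : 0 ≤ τ)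
    (κ₀ : ℝ) (hκ₀ : τ / p < κ₀) (hκeq : κ₀ / 2 * LambdaStar p (τ / κ₀) = 1)
    (ε : ℝ) (hε0 : 0 < ε) (hεκ : ε < κ₀)
    (t : ℕ → ℕ) (ht : Tendsto (fun n => (t n : ℝ) / Real.log n) atTop (nhds τ))
    (k : ℕ → ℕ) (hkpos : ∀ n, 0 < k n)
    (hk : Tendsto (fun n => (k n : ℝ) / Real.log n) atTop (nhds (κ₀ - ε))) :
    ∃ c : ℝ, 0 < c ∧ ∃ n₀ : ℕ, ∀ n ≥ n₀,
      erMeasure n p {G | tDependenceNumber G (t n) < k n}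
        ≤ ENNReal.ofReal (Real.exp (-c * (n : ℝ) ^ 2 / Real.log n ^ 5)) := by
  have hκ₀' : 0 < κ₀ := (div_nonneg hτ hp0.le).trans_lt hκ₀
  set y := τ / κ₀ with hy
  have hy0 : 0 ≤ y := div_nonneg hτ hκ₀'.le
  have hyp : y < p := by
    rw [div_lt_iff₀ hp0] at hκ₀
    rw [hy, div_lt_iff₀ hκ₀']
    linarith
  set κ₁ := κ₀ - ε / 2 with hκ₁def
  have hκ₁ : 0 < κ₁ := by linarith
  have hκ : κ₁ < κ₀ := by linarith
  have hq : 0 < 1 - p := sub_pos.2 hp1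
  have hlog : Tendsto (fun n : ℕ => Real.log n) atTop atTop :=
    Real.tendsto_log_atTop.comp tendsto_natCast_atTop_atTop
  have hkev : ∀ᶠ n : ℕ in atTop, (k n : ℝ) ≤ κ₁ * Real.log n := by
    filter_upwards [hk.eventually_lt_const (by linarith : κ₀ - ε < κ₁),
      hlog.eventually_gt_atTop 0] with n hn hL
    exact ((div_lt_iff₀ hL).1 hn).le
  have htev : ∀ᶠ n : ℕ in atTop, y * κ₁ * Real.log n ≤ t n := by
    rcases hy0.eq_or_lt with h0 | h0
    · refine Eventually.of_forall fun n => ?_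
      rw [← h0, zero_mul, zero_mul]
      exact Nat.cast_nonneg _
    · have hlt : y * κ₁ < τ := by
        calc y * κ₁ < y * κ₀ := mul_lt_mul_of_pos_left hκ h0
          _ = τ := div_mul_cancel₀ _ hκ₀'.ne'
      filter_upwards [ht.eventually_const_lt hlt, hlog.eventually_gt_atTop 0] with n hn hL
      exact ((lt_div_iff₀ hL).1 hn).le
  obtain ⟨n₀, hn₀⟩ := eventually_atTop.1 <|
    (eventually_overlap_le hp0 hp1 hy0 hyp hκ₁ hκ hκeq).and <|
      hkev.and <| htev.and <| hlog.eventually_gt_atTop 0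
  refine ⟨(1 - p) / (64 * κ₀ ^ 5), by positivity, n₀, fun n hn => ?_⟩
  obtain ⟨hov, hkn, htn, hL⟩ := hn₀ n hn
  obtain ⟨k', hk'⟩ : ∃ k', k' = ⌈κ₁ * Real.log n⌉₊ := ⟨_, rfl⟩
  obtain ⟨t', ht'⟩ : ∃ t', t' = ⌈y * ((k' : ℝ) - 1)⌉₊ := ⟨_, rfl⟩
  obtain ⟨h2, hle, hkκ, hratio⟩ := hov k' t' hk' ht'
  have hkk' : k n ≤ k' := by
    have : (k n : ℝ) ≤ k' := hkn.trans (hk' ▸ Nat.le_ceil _)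
    exact_mod_cast this
  have htt' : t' ≤ t n := by
    rw [ht']
    refine Nat.ceil_le.2 (le_trans ?_ htn)
    have := (Nat.ceil_lt_add_one (mul_pos hκ₁ hL).le).le
    rw [← hk'] at this
    rw [mul_assoc]
    exact mul_le_mul_of_nonneg_left (by linarith) hy0
  have hJ := bernProb_no_degLE_le (V := Fin n) (t := t') hp0.le hp1 h2 (by simpa using hle)
    (one_div_pos.2 hq) (by simpa using hratio)
  rw [erMeasure_apply hp0.le hp1.le]
  refine ENNReal.ofReal_le_ofReal ((bernProb_mono (fun _ => hp0.le) (fun _ => hp1.le)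
    fun f hf S hS hfS => ?_).trans (hJ.trans (Real.exp_le_exp.2 ?_)))
  · have h := le_tDependenceNumber htt' hfS
    have hf' : tDependenceNumber (SimpleGraph.fromEdgeSet {e | f e = true}) (t n) < k n := hf
    omega
  · rw [Fintype.card_fin, neg_mul, neg_div]
    refine neg_le_neg ?_
    have hk0 : (0 : ℝ) < k' := by
      have : 0 < k' := by omega
      exact_mod_cast this
    calc (1 - p) / (64 * κ₀ ^ 5) * (n : ℝ) ^ 2 / Real.log n ^ 5
        = (n : ℝ) ^ 2 / (2 * (1 / (1 - p)) * (2 * κ₀ * Real.log n) ^ 5) := by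
          field_simp
          ring
      _ ≤ _ := by gcongr
end

section
/- Suppose 0 < p(n) < 1 with p(n) = o(1), set d(n) = n·p(n), and suppose d(n) ≥ 4 for all sufficiently large n. Fix τ ≥ 0 and suppose t(n) is a sequence of nonnegative integers with t(n)/ln d(n) → τ as n → ∞. Let κ be any constant with κ > κ(τ), where κ(τ) is the unique κ' > τ with (1/2)·(κ' − τ − τ·ln(κ'/τ)) = 1 (interpreting τ·ln(κ'/τ) = 0 when τ = 0). Then asymptotically almost surely χ^{t(n)}(G(n,p(n))) ≥ d(n)/(κ·ln d(n)). -/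
open MeasureTheory Filter
open scoped ENNReal NNReal

lemma isProbabilityMeasure_bernoulliBool {p : ℝ} (hp0 : 0 ≤ p) (hp1 : p ≤ 1) :
    IsProbabilityMeasure (bernoulliBool p) := by
  constructor
  simp only [bernoulliBool, Measure.add_apply, Measure.smul_apply, measure_univ]
  rw [← add_smul, ← Real.toNNReal_add hp0 (by linarith)]
  simp

lemma integral_bernoulliBool {p : ℝ} (hp0 : 0 ≤ p) (hp1 : p ≤ 1) (f : Bool → ℝ) :
    ∫ b, f b ∂bernoulliBool p = p * f true + (1 - p) * f false := by
  rw [bernoulliBool, integral_add_measure Integrable.of_finite Integrable.of_finite,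
    integral_smul_nnreal_measure, integral_smul_nnreal_measure]
  simp [NNReal.smul_def, hp0, hp1]

lemma isProbabilityMeasure_erMeasure (n : ℕ) {p : ℝ} (hp0 : 0 ≤ p) (hp1 : p ≤ 1) :
    IsProbabilityMeasure (erMeasure n p) := by
  have := isProbabilityMeasure_bernoulliBool hp0 hp1
  exact Measure.isProbabilityMeasure_map (Measurable.of_discrete).aemeasurable

lemma IsTDependent.mono {V : Type*} [Finite V] {G : SimpleGraph V} {t : ℕ} {S T : Set V}
    (h : IsTDependent G t T) (hST : S ⊆ T) : IsTDependent G t S := fun v hv =>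
  (Set.ncard_le_ncard (Set.ofPred_subset_ofPred.2 fun _ hu => ⟨hST hu.1, hu.2⟩)
    (Set.toFinite _)).trans (h v (hST hv))

/-- A `t`-dependent set `S` spans at most `t|S|/2` edges. -/
lemma IsTDependent.two_mul_card_edges_le {V : Type*} [Fintype V] {G : SimpleGraph V} {t : ℕ}
    {S : Finset V} (h : IsTDependent G t (S : Set V)) {F : Finset (Sym2 V)}
    (hFG : ∀ e ∈ F, e ∈ G.edgeSet) (hFS : ∀ e ∈ F, ∀ v ∈ e, v ∈ S) :
    2 * F.card ≤ t * S.card := by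
  classical
  let H : SimpleGraph V :=
    { Adj := fun u v => u ∈ S ∧ v ∈ S ∧ G.Adj u v
      symm := ⟨fun u v huv => ⟨huv.2.1, huv.1, huv.2.2.symm⟩⟩
      loopless := ⟨fun u hu => hu.2.2.ne rfl⟩ }
  have hF : F ⊆ H.edgeFinset := by
    intro e he
    have hG := hFG e he
    have hS := hFS e he
    induction e with
    | _ a b =>
      exact SimpleGraph.mem_edgeFinset.2 ⟨hS a (Sym2.mem_mk_left a b),
        hS b (Sym2.mem_mk_right a b), hG⟩
  refine (Nat.mul_le_mul_left 2 (Finset.card_le_card hF)).trans ?_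
  rw [← H.sum_degrees_eq_twice_card_edges,
    ← Finset.sum_subset S.subset_univ (f := fun v => H.degree v), mul_comm, ← smul_eq_mul]
  · refine Finset.sum_le_card_nsmul _ _ _ fun v hv => ?_
    refine le_trans (le_of_eq ?_) (h v hv)
    rw [← SimpleGraph.card_neighborFinset_eq_degree, ← Set.ncard_coe_finset]
    congr 1
    ext u
    simp [H, Finset.mem_coe.1 hv]
  · intro v _ hv
    rw [SimpleGraph.degree_eq_zero_iff_notMem_support, SimpleGraph.mem_support]
    rintro ⟨u, hu⟩
    exact hv hu.1

open Classical in
/-- Exponential-moment bound for the probability that a fixed set is `t`-dependent. -/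
lemma erMeasure_isTDependent_le (n : ℕ) {p w : ℝ} (hp0 : 0 ≤ p) (hp1 : p ≤ 1) (hw0 : 0 < w)
    (hw1 : w ≤ 1) (S : Finset (Fin n)) (t : ℕ) :
    w ^ (t * S.card) * (erMeasure n p).real {G | IsTDependent G t (S : Set (Fin n))} ≤
      (1 - p * (1 - w ^ 2)) ^ S.card.choose 2 := by
  have := isProbabilityMeasure_bernoulliBool hp0 hp1
  set E : Finset (Sym2 (Fin n)) := S.offDiag.image Sym2.mk.uncurry
  let X : (Sym2 (Fin n) → Bool) → ℝ := fun f =>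
    ∏ e, if e ∈ E ∧ f e = true then w ^ 2 else 1
  have hX : ∀ f, X f = (w ^ 2) ^ {e ∈ E | f e = true}.card := by
    intro f
    simp only [X]
    rw [Finset.prod_ite]
    rw [Finset.prod_const, Finset.prod_const_one, mul_one]
    congr 2
    ext e
    simp
  have hint : ∫ f, X f ∂(Measure.pi fun _ : Sym2 (Fin n) => bernoulliBool p) =
      (1 - p * (1 - w ^ 2)) ^ S.card.choose 2 := by
    rw [integral_fintype_prod_eq_prod
      (f := fun (e : Sym2 (Fin n)) (b : Bool) => if e ∈ E ∧ b = true then w ^ 2 else (1 : ℝ))]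
    have hcard : E.card = S.card.choose 2 := Sym2.card_image_offDiag S
    rw [← hcard, ← Finset.prod_const, ← Finset.prod_subset E.subset_univ]
    · refine Finset.prod_congr rfl fun e he => ?_
      rw [integral_bernoulliBool hp0 hp1]
      simp [he]
      ring
    · intro e _ he
      rw [integral_bernoulliBool hp0 hp1]
      simp [he]
  rw [← hint]
  refine le_trans ?_ (mul_meas_ge_le_integral_of_nonneg (ε := w ^ (t * S.card))
    (Filter.Eventually.of_forall fun f => by rw [hX]; positivity) Integrable.of_finite)
  gcongr
  rw [erMeasure, map_measureReal_apply Measurable.of_discrete (MeasurableSet.of_discrete)]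
  refine measureReal_mono fun f hf => ?_
  simp only [Set.mem_preimage, Set.mem_ofPred_eq] at hf ⊢
  rw [hX, ← pow_mul]
  refine pow_le_pow_of_le_one hw0.le hw1 (hf.two_mul_card_edges_le ?_ ?_)
  all_goals
    intro e he
    rw [Finset.mem_filter] at he
    obtain ⟨⟨a, b⟩, hab, rfl⟩ := Finset.mem_image.1 he.1
    simp only [Finset.mem_offDiag] at hab
  · simpa [hab.2.2] using he.2
  · intro v hv
    rcases Sym2.mem_iff.1 hv with rfl | rfl
    exacts [hab.1, hab.2.1]

lemma exists_coloring_improperChromaticNumber {V : Type*} [Fintype V] (G : SimpleGraph V) (t : ℕ) :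
    ∃ c : V → Fin (improperChromaticNumber G t), ∀ i, IsTDependent G t {v | c v = i} := by
  refine Nat.sInf_mem (s := {k | ∃ c : V → Fin k, ∀ i : Fin k, IsTDependent G t {v | c v = i}})
    ⟨Fintype.card V, Fintype.equivFin V, fun i v hv => ?_⟩
  have hempty : {u ∈ {v | Fintype.equivFin V v = i} | G.Adj v u} = ∅ := by
    ext u
    simp only [Set.mem_ofPred_eq, Set.mem_empty_iff_false, iff_false, not_and] at hv ⊢
    intro hu hvu
    exact hvu.ne ((Fintype.equivFin V).injective (hv.trans hu.symm))
  rw [hempty]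
  simp

/-- If there are few colours, some colour class contains a large `t`-dependent set. -/
lemma exists_isTDependent_of_mul_lt {n t k : ℕ} {x : ℝ} (G : SimpleGraph (Fin n))
    (hk : (k : ℝ) < x + 1) (h : (improperChromaticNumber G t : ℝ) * x < n) :
    ∃ S ∈ Finset.univ.powersetCard k, IsTDependent G t ((S : Finset (Fin n)) : Set (Fin n)) := by
  classical
  obtain ⟨c, hc⟩ := exists_coloring_improperChromaticNumber G t
  have hcard : (Fintype.card (Fin (improperChromaticNumber G t)) : ℕ) • x <
      Fintype.card (Fin n) := by
    simpa using h
  obtain ⟨i, hi⟩ := Fintype.exists_lt_card_fiber_of_nsmul_lt_card (M := ℝ) c hcard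
  have hki : k ≤ (Finset.univ.filter fun v => c v = i).card := by
    have : (k : ℝ) < (Finset.univ.filter fun v => c v = i).card + 1 := by linarith
    exact Nat.lt_succ_iff.1 (by exact_mod_cast this)
  obtain ⟨S, hS, hSk⟩ := Finset.exists_subset_card_eq hki
  refine ⟨S, Finset.mem_powersetCard.2 ⟨S.subset_univ, hSk⟩, (hc i).mono fun v hv => ?_⟩
  simpa using hS hv

lemma choose_le_exp_mul_div_pow (n : ℕ) {k : ℕ} (hk : 0 < k) :
    (n.choose k : ℝ) ≤ (Real.exp 1 * n / k) ^ k := by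
  have h1 : (n.choose k : ℝ) ≤ n ^ k / k.factorial := Nat.choose_le_pow_div k n
  have h2 : (k : ℝ) ^ k / k.factorial ≤ Real.exp k := Real.pow_div_factorial_le_exp _ (by simp) k
  have hk' : (0 : ℝ) < k := by exact_mod_cast hk
  rw [div_pow, mul_pow, ← Real.exp_nat_mul, mul_one, le_div_iff₀ (by positivity)]
  calc (n.choose k : ℝ) * k ^ k ≤ n ^ k / k.factorial * k ^ k := by gcongr
    _ = (k ^ k / k.factorial) * n ^ k := by ring
    _ ≤ _ := by gcongr

/-- A first-moment bound on the existence of `t`-dependent sets of size `k`. -/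
lemma erMeasure_exists_isTDependent_le (n : ℕ) {p w : ℝ} (hp0 : 0 ≤ p) (hp1 : p ≤ 1) (hw0 : 0 < w)
    (hw1 : w ≤ 1) (t : ℕ) {k : ℕ} (hk : 0 < k) :
    (erMeasure n p).real {G | ∃ S ∈ Finset.univ.powersetCard k,
      IsTDependent G t ((S : Finset (Fin n)) : Set (Fin n))} ≤
      (Real.exp 1 * n / k *
        Real.exp (-(p * (1 - w ^ 2) * (k - 1) / 2) - t * Real.log w)) ^ k := by
  have := isProbabilityMeasure_erMeasure n hp0 hp1
  have hw2 : w ^ 2 ≤ 1 := pow_le_one₀ hw0.le hw1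
  have hset : ∀ S ∈ (Finset.univ : Finset (Fin n)).powersetCard k,
      (erMeasure n p).real {G | IsTDependent G t (S : Set (Fin n))} ≤
        Real.exp (-(p * (1 - w ^ 2) * (k - 1) / 2) - t * Real.log w) ^ k := by
    intro S hS
    have hcard := (Finset.mem_powersetCard.1 hS).2
    have h := erMeasure_isTDependent_le n hp0 hp1 hw0 hw1 S t
    rw [hcard] at h
    have hexp : 1 - p * (1 - w ^ 2) ≤ Real.exp (-(p * (1 - w ^ 2))) := by
      linarith [Real.add_one_le_exp (-(p * (1 - w ^ 2)))]
    have hpos : 0 ≤ 1 - p * (1 - w ^ 2) := by nlinarith [sq_nonneg w]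
    have hpow : w ^ (t * k) = Real.exp (t * k * Real.log w) := by
      rw [← Real.exp_log (pow_pos hw0 (t * k)), Real.log_pow]
      push_cast
      rfl
    have h' := h.trans (pow_le_pow_left₀ hpos hexp _)
    rw [hpow, ← Real.exp_nat_mul, Nat.cast_choose_two, mul_comm, ← le_div_iff₀ (Real.exp_pos _),
      ← Real.exp_sub] at h'
    rw [← Real.exp_nat_mul]
    refine h'.trans (le_of_eq ?_)
    congr 1
    ring
  have hun : {G | ∃ S ∈ Finset.univ.powersetCard k,
      IsTDependent G t ((S : Finset (Fin n)) : Set (Fin n))} =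
      ⋃ S ∈ (Finset.univ : Finset (Fin n)).powersetCard k,
        {G | IsTDependent G t (S : Set (Fin n))} := by
    ext G
    simp
  rw [hun]
  refine (measureReal_biUnion_finset_le _ _).trans ((Finset.sum_le_card_nsmul _ _ _ hset).trans ?_)
  rw [Finset.card_powersetCard, Finset.card_univ, Fintype.card_fin, nsmul_eq_mul, mul_pow]
  gcongr
  exact choose_le_exp_mul_div_pow n hk

lemma two_le_of_rate_eq_one {τ κ₀ : ℝ} (hτ : 0 ≤ τ) (hκ₀ : τ < κ₀)
    (hκeq : (κ₀ - τ - τ * Real.log (κ₀ / τ)) / 2 = 1) : 2 ≤ κ₀ := by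
  rcases hτ.eq_or_lt with rfl | hτ
  · simp at hκeq
    linarith
  · have := mul_nonneg hτ.le (Real.log_nonneg ((one_le_div hτ).2 hκ₀.le))
    linarith

/-- Above the critical constant, some exponential tilt gives a rate exceeding `1`. -/
lemma exists_tilt {τ κ₀ κ : ℝ} (hτ : 0 ≤ τ) (hκ₀ : τ < κ₀)
    (hκeq : (κ₀ - τ - τ * Real.log (κ₀ / τ)) / 2 = 1) (hκ : κ₀ < κ) :
    ∃ w : ℝ, 0 < w ∧ w ≤ 1 ∧ 2 < (1 - w ^ 2) * κ + 2 * (τ * Real.log w) := by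
  have h2 := two_le_of_rate_eq_one hτ hκ₀ hκeq
  rcases hτ.eq_or_lt with rfl | hτ
  · have hpos : 0 < (1 - 2 / κ) / 2 := by
      have : 2 / κ < 1 := (div_lt_one (by linarith)).2 (by linarith)
      linarith
    refine ⟨√((1 - 2 / κ) / 2), Real.sqrt_pos.2 hpos, ?_, ?_⟩
    · rw [Real.sqrt_le_one]
      have : 0 < 2 / κ := by apply div_pos <;> linarith
      linarith
    · rw [Real.sq_sqrt hpos.le]
      have : (1 - (1 - 2 / κ) / 2) * κ = (κ + 2) / 2 := by
        have : κ ≠ 0 := by linarith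
        field_simp
        ring
      rw [this]
      linarith
  · have hκ₀' : 0 < κ₀ := by linarith
    have hlt : τ / κ₀ < 1 := (div_lt_one hκ₀').2 hκ₀
    refine ⟨√(τ / κ₀), Real.sqrt_pos.2 (by positivity), Real.sqrt_le_one.2 hlt.le, ?_⟩
    rw [Real.sq_sqrt (by positivity), Real.log_sqrt (by positivity), ← inv_div κ₀ τ, Real.log_inv,
      inv_div]
    have h1 : (1 - τ / κ₀) * κ₀ = κ₀ - τ := by field_simp
    have h3 : 0 < (1 - τ / κ₀) * (κ - κ₀) := mul_pos (by linarith) (by linarith)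
    linarith

lemma two_mul_log_two_le_log {d : ℝ} (hd : 4 ≤ d) : 2 * Real.log 2 ≤ Real.log d := by
  have : Real.log 4 = 2 * Real.log 2 := by
    rw [show (4 : ℝ) = 2 ^ 2 by norm_num, Real.log_pow]
    norm_num
  rw [← this]
  exact Real.log_le_log (by norm_num) hd

/-- Quantitative lower bound on the upper tail of the improper chromatic number. -/
lemma one_sub_le_erMeasure_improperChromaticNumber {n t : ℕ} {p w κ : ℝ} (hp0 : 0 < p)
    (hp1 : p ≤ 1) (hd : 4 ≤ n * p) (hκ : 2 ≤ κ) (hw0 : 0 < w) (hw1 : w ≤ 1)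
    (hrate : 2 ≤ (1 - w ^ 2) * κ - p + 2 * (t / Real.log (n * p) * Real.log w)) :
    1 - (Real.exp 1 / (4 * Real.log 2)) ^ ⌈κ * Real.log (n * p) / p⌉₊ ≤
      (erMeasure n p).real {G | n * p / (κ * Real.log (n * p)) ≤
        (improperChromaticNumber G t : ℝ)} := by
  have := isProbabilityMeasure_erMeasure n hp0.le hp1
  have hlog2 := Real.log_two_gt_d9
  have hL4 := two_mul_log_two_le_log hd
  set L := Real.log (n * p) with hL
  have hL1 : 1 ≤ L := by linarith
  have hκ0 : 0 < κ := by linarith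
  have hx : 0 < κ * L / p := by positivity
  set k := ⌈κ * L / p⌉₊
  have hk0 : 0 < k := Nat.ceil_pos.2 hx
  have hkx : κ * L / p ≤ k := Nat.le_ceil _
  have hw2 : 0 ≤ 1 - w ^ 2 := by linarith [pow_le_one₀ hw0.le hw1 (n := 2)]
  have hw2' : 1 - w ^ 2 ≤ 1 := by linarith [sq_nonneg w]
  have hexp : -(p * (1 - w ^ 2) * (k - 1) / 2) - t * Real.log w ≤ -L := by
    have h1 : κ * L ≤ p * k := by rwa [div_le_iff₀' hp0] at hkx
    have h2 : (1 - w ^ 2) * (κ * L) ≤ (1 - w ^ 2) * (p * k) := mul_le_mul_of_nonneg_left h1 hw2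
    have h3 : 2 * L ≤ (1 - w ^ 2) * (κ * L) - p * L + 2 * (t * Real.log w) := by
      have h4 := mul_le_mul_of_nonneg_right hrate (by linarith : 0 ≤ L)
      have h5 : t / L * Real.log w * L = t * Real.log w := by field_simp
      linear_combination h4 + 2 * h5
    have h4 : p * (1 - w ^ 2) ≤ p * L := by gcongr; linarith
    linear_combination h3 / 2 + h2 / 2 + h4 / 2
  have hn : (0 : ℝ) < n := by
    by_contra! h
    nlinarith
  have hbase : Real.exp 1 * n / k *
      Real.exp (-(p * (1 - w ^ 2) * (k - 1) / 2) - t * Real.log w) ≤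
      Real.exp 1 / (4 * Real.log 2) := by
    calc _ ≤ Real.exp 1 * n / (κ * L / p) * Real.exp (-L) := by gcongr
      _ = Real.exp 1 / (κ * L) := by
        rw [Real.exp_neg, hL, Real.exp_log (by positivity), ← hL]
        field_simp
      _ ≤ _ := by
        refine div_le_div_of_nonneg_left (Real.exp_pos 1).le (by positivity) ?_
        nlinarith
  have hfirst := (erMeasure_exists_isTDependent_le n hp0.le hp1 hw0 hw1 t hk0).trans
    (pow_le_pow_left₀ (by positivity) hbase k)
  have hcompl : {G : SimpleGraph (Fin n) | n * p / (κ * L) ≤ (improperChromaticNumber G t : ℝ)}ᶜ ⊆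
      {G | ∃ S ∈ Finset.univ.powersetCard k,
        IsTDependent G t ((S : Finset (Fin n)) : Set (Fin n))} := by
    intro G hG
    rw [Set.mem_compl_iff, Set.mem_ofPred_eq, not_le] at hG
    refine exists_isTDependent_of_mul_lt G (Nat.ceil_lt_add_one hx.le) ?_
    calc _ < n * p / (κ * L) * (κ * L / p) := by gcongr
      _ = n := by field_simp
  have hle := (measureReal_mono hcompl).trans hfirst
  rw [probReal_compl_eq_one_sub MeasurableSet.of_discrete] at hle
  linarith

/-- Suppose `0 < p(n) < 1`, `p(n) = o(1)`, `d(n) = n·p(n) ≥ 4` for large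
`n`, and `t(n)/ln d(n) → τ ≥ 0`.  Let `κ₀ = κ(τ)` be the unique `κ' > τ` with
`(κ' - τ - τ·ln(κ'/τ))/2 = 1` (with `τ·ln(κ'/τ) = 0` when `τ = 0`, automatic since
`Real.log 0 = 0`), and let `κ > κ₀`.  Then a.a.s. `χ^{t(n)}(G(n,p(n))) ≥ d/(κ·ln d)`. -/
theorem stmt18 (p : ℕ → ℝ) (hp : ∀ n, 0 < p n ∧ p n < 1)
    (hp0 : Tendsto p atTop (nhds 0))
    (hd4 : ∀ᶠ n : ℕ in atTop, (4 : ℝ) ≤ (n : ℝ) * p n)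
    (τ : ℝ) (hτ : 0 ≤ τ)
    (t : ℕ → ℕ)
    (ht : Tendsto (fun n => (t n : ℝ) / Real.log ((n : ℝ) * p n)) atTop (nhds τ))
    (κ₀ : ℝ) (hκ₀ : τ < κ₀) (hκeq : (κ₀ - τ - τ * Real.log (κ₀ / τ)) / 2 = 1)
    (hκuniq : ∀ κ' : ℝ, τ < κ' → (κ' - τ - τ * Real.log (κ' / τ)) / 2 = 1 → κ' = κ₀)
    (κ : ℝ) (hκ : κ₀ < κ) :
    Tendsto (fun n => erMeasure n (p n)
        {G | ((n : ℝ) * p n) / (κ * Real.log ((n : ℝ) * p n))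
              ≤ (improperChromaticNumber G (t n) : ℝ)})
      atTop (nhds 1) := by
  obtain ⟨w, hw0, hw1, hw⟩ := exists_tilt hτ hκ₀ hκeq hκ
  have hκ2 : 2 ≤ κ := (two_le_of_rate_eq_one hτ hκ₀ hκeq).trans hκ.le
  have hprob := fun n => isProbabilityMeasure_erMeasure n (hp n).1.le (hp n).2.le
  have hlog2 := Real.log_two_gt_d9
  have hrate : ∀ᶠ n : ℕ in atTop,
      2 < (1 - w ^ 2) * κ - p n + 2 * (t n / Real.log (n * p n) * Real.log w) := by
    have hlim := (tendsto_const_nhds (x := (1 - w ^ 2) * κ)).sub hp0 |>.add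
      ((ht.mul_const (Real.log w)).const_mul 2)
    exact hlim.eventually (lt_mem_nhds (by linarith))
  have hk : Tendsto (fun n : ℕ => ⌈κ * Real.log (n * p n) / p n⌉₊) atTop atTop := by
    refine tendsto_nat_ceil_atTop.comp ?_
    have hinv : Tendsto (fun n => (p n)⁻¹) atTop atTop :=
      tendsto_inv_nhdsGT_zero.comp (tendsto_nhdsWithin_iff.2
        ⟨hp0, Eventually.of_forall fun n => (hp n).1⟩)
    refine tendsto_atTop_mono' _ ?_ hinv
    filter_upwards [hd4] with n hn
    have hL := two_mul_log_two_le_log hn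
    have := (hp n).1
    rw [inv_eq_one_div]
    gcongr
    nlinarith
  have hq : Tendsto (fun n : ℕ => 1 - (Real.exp 1 / (4 * Real.log 2)) ^
      ⌈κ * Real.log (n * p n) / p n⌉₊) atTop (nhds 1) := by
    have h := (tendsto_pow_atTop_nhds_zero_of_lt_one (r := Real.exp 1 / (4 * Real.log 2))
      (by positivity) ((div_lt_one (by positivity)).2
        (by linarith [Real.exp_one_lt_d9]))).comp hk
    simpa using h.const_sub 1
  rw [← ENNReal.tendsto_toReal_iff (fun n => measure_ne_top _ _) ENNReal.one_ne_top,
    ENNReal.toReal_one]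
  refine tendsto_of_tendsto_of_tendsto_of_le_of_le' hq tendsto_const_nhds ?_
    (Eventually.of_forall fun n => measureReal_le_one)
  filter_upwards [hd4, hrate] with n hn hr
  exact one_sub_le_erMeasure_improperChromaticNumber (hp n).1 (hp n).2.le hn hκ2 hw0 hw1 hr.le
end
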